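/- Let R be a Noetherian ring of prime characteristic p with finite F-representation type by finitely generated R-modules M_1, …, M_t. Let I be an ideal of R and n an integer. Then Ass_R H_I^n(R) ∩ Gor R ⊆ ⋃_{i=1}^t Ass_R Ext_R^n(M_i/IM_i, R). In particular, Ass_R H_I^n(R) is a finite set if R is a semilocal ring such that R_𝔭 is Gorenstein for each nonmaximal prime ideal 𝔭. -/

import Mathlib

/-!
Statement 4: If `R` is a Noetherian ring of prime characteristic `p` with finite
F-representation type by finitely generated modules `M_1, …, M_t`, `I` an ideal and
`n` an integer, then `Ass_R H_I^n(R) ∩ Gor R ⊆ ⋃_i Ass_R Ext_R^n(M_i/IM_i, R)`.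
In particular `Ass_R H_I^n(R)` is finite if `R` is semilocal with `R_𝔭` Gorenstein for
each nonmaximal prime `𝔭`.
-/

open CategoryTheory

open scoped DirectSum

universe u

section Defs

variable (R : Type u) [CommRing R]

/-- `Ext_R^i(M, N)` via Mathlib's `Ext` functor on `ModuleCat R`. -/
noncomputable def extCat (i : ℕ) (M N : ModuleCat.{u} R) : ModuleCat.{u} R :=
  ((Ext R (ModuleCat.{u} R) i).obj (Opposite.op M)).obj N

/-- `R` is a Gorenstein local ring: Noetherian local with finite injective dimension
as a module over itself. -/
def IsGorensteinLocalRing : Prop :=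
  IsLocalRing R ∧ IsNoetherianRing R ∧
  ∃ n : ℕ, ∀ (M : ModuleCat.{u} R) (i : ℕ), n < i →
    Subsingleton (extCat R i M (ModuleCat.of R R))

/-- The Gorenstein locus of `R`: primes `𝔭` with `R_𝔭` a Gorenstein local ring. -/
def gorensteinLocus : Set (Ideal R) :=
  {P | ∃ h : P.IsPrime, IsGorensteinLocalRing (Localization (@Ideal.primeCompl R _ P h))}

end Defs

section ExtRegular

open RingTheory.Sequence

variable {R : Type u} [CommRing R]

lemma ext_comp_mk₀_smul_id {A M : ModuleCat.{u} R} {n : ℕ} (e : Abelian.Ext A M n) (r : R) :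
    e.comp (Abelian.Ext.mk₀ (r • 𝟙 M)) (add_zero n) = r • e :=
  (Abelian.Ext.smul_eq_comp_mk₀ e r).symm

lemma mk₀_smul_id_comp_ext {A M : ModuleCat.{u} R} {n : ℕ} (e : Abelian.Ext A M n) (r : R) :
    (Abelian.Ext.mk₀ (r • 𝟙 A)).comp e (zero_add n) = r • e := by
  simp [Abelian.Ext.mk₀_smul]

lemma smul_ext_eq_zero_of_mem_annihilator {A M : ModuleCat.{u} R} {n : ℕ}
    (e : Abelian.Ext A M n) {r : R} (hr : r ∈ Module.annihilator R A) : r • e = 0 := by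
  have h : r • 𝟙 A = 0 := by
    simp [← ModuleCat.lsmul_eq_smul_id, Module.mem_annihilator_iff_lsmul_eq_zero.mp hr]
  rw [← mk₀_smul_id_comp_ext, h, Abelian.Ext.mk₀_zero, Abelian.Ext.zero_comp]

/-- If `r` is regular on `M` and kills `A`, every class in `Ext A M (n + 1)` comes from
`Ext A (M / rM) n` through the connecting map. -/
lemma exists_comp_extClass_eq_of_mem_annihilator {A M : ModuleCat.{u} R} {r : R}
    (hr : IsSMulRegular M r) (hA : r ∈ Module.annihilator R A) {n : ℕ}
    (e : Abelian.Ext A M (n + 1)) :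
    ∃ e' : Abelian.Ext A (M.smulShortComplex r).X₃ n,
      e'.comp hr.smulShortComplex_shortExact.extClass rfl = e := by
  refine Abelian.Ext.covariant_sequence_exact₁ A hr.smulShortComplex_shortExact e ?_ rfl
  exact (ext_comp_mk₀_smul_id e r).trans (smul_ext_eq_zero_of_mem_annihilator e hA)

/-- Below the length of a weakly regular sequence on `M` annihilating `A`, all `Ext A M j`
vanish. -/
lemma ext_subsingleton_of_isWeaklyRegular {rs : List R} {M : ModuleCat.{u} R}
    (h : IsWeaklyRegular M rs) {A : ModuleCat.{u} R}
    (hA : ∀ r ∈ rs, r ∈ Module.annihilator R A) {j : ℕ} (hj : j < rs.length) :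
    Subsingleton (Abelian.Ext A M j) := by
  induction rs generalizing M j with
  | nil => simp at hj
  | cons x xs ih =>
    rw [isWeaklyRegular_cons_iff] at h
    refine subsingleton_of_forall_eq 0 fun e ↦ ?_
    cases j with
    | zero =>
      have := h.1.smulShortComplex_shortExact.mono_f
      exact Abelian.Ext.postcomp_mk₀_injective_of_mono A (M.smulShortComplex x).f
        ((ext_comp_mk₀_smul_id e x).trans
          ((smul_ext_eq_zero_of_mem_annihilator e (hA x (by simp))).trans
            (map_zero ((Abelian.Ext.mk₀ (M.smulShortComplex x).f).postcomp A _)).symm))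
    | succ j =>
      obtain ⟨e', rfl⟩ := exists_comp_extClass_eq_of_mem_annihilator h.1 (hA x (by simp)) e
      have : Subsingleton (Abelian.Ext A (M.smulShortComplex x).X₃ j) :=
        ih (M := (M.smulShortComplex x).X₃) h.2 (fun r hr ↦ hA r (by simp [hr]))
          (by simpa using hj)
      rw [Subsingleton.elim e' 0, Abelian.Ext.zero_comp]
      rfl

/-- If `rs` is weakly regular on `M`, annihilates `A`, and `Ext A M rs.length` is nonzero, then
there is a nonzero map `A → M / rs M`. -/
lemma exists_linearMap_ne_zero_of_ext_ne_zero {rs : List R} {M : ModuleCat.{u} R}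
    (h : IsWeaklyRegular M rs) {A : ModuleCat.{u} R}
    (hA : ∀ r ∈ rs, r ∈ Module.annihilator R A) (e : Abelian.Ext A M rs.length) (he : e ≠ 0) :
    ∃ f : A →ₗ[R] M ⧸ (Ideal.ofList rs • (⊤ : Submodule R M)), f ≠ 0 := by
  induction rs generalizing M with
  | nil =>
    obtain ⟨f, rfl⟩ := (Abelian.Ext.mk₀_bijective A M).2 e
    have hbot : Ideal.ofList ([] : List R) • (⊤ : Submodule R M) = ⊥ := by simp
    refine ⟨(Submodule.quotEquivOfEqBot _ hbot).symm.toLinearMap ∘ₗ f.hom, fun h0 ↦ he ?_⟩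
    have : f = 0 := by
      ext a
      simpa using DFunLike.congr_fun h0 a
    rw [this, Abelian.Ext.mk₀_zero]
  | cons x xs ih =>
    rw [isWeaklyRegular_cons_iff] at h
    obtain ⟨e', rfl⟩ := exists_comp_extClass_eq_of_mem_annihilator h.1 (hA x (by simp)) e
    obtain ⟨f, hf⟩ := ih (M := (M.smulShortComplex x).X₃) h.2 (fun r hr ↦ hA r (by simp [hr])) e'
      (by rintro rfl; exact he (Abelian.Ext.zero_comp _ _ _ _ _))
    let E := Submodule.quotOfListConsSMulTopEquivQuotSMulTopInner M x xs
    refine ⟨E.symm.toLinearMap ∘ₗ f, fun h0 ↦ hf ?_⟩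
    ext a
    exact E.symm.injective ((DFunLike.congr_fun h0 a).trans (map_zero E.symm).symm)

/-- If `rs` is weakly regular on `M` and annihilates `A` and `B`, and restriction along
`i : A ⟶ B` is surjective on `Ext _ M rs.length`, then every map `A → M / rs M` extends to `B`. -/
lemma exists_extension_of_ext_surjective {rs : List R} {M : ModuleCat.{u} R}
    (h : IsWeaklyRegular M rs) {A B : ModuleCat.{u} R} (i : A ⟶ B)
    (hA : ∀ r ∈ rs, r ∈ Module.annihilator R A) (hB : ∀ r ∈ rs, r ∈ Module.annihilator R B)
    (hi : ∀ e : Abelian.Ext A M rs.length, ∃ e' : Abelian.Ext B M rs.length,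
      (Abelian.Ext.mk₀ i).comp e' (zero_add _) = e)
    (f : A →ₗ[R] M ⧸ (Ideal.ofList rs • (⊤ : Submodule R M))) :
    ∃ g : B →ₗ[R] M ⧸ (Ideal.ofList rs • (⊤ : Submodule R M)), g ∘ₗ i.hom = f := by
  induction rs generalizing M with
  | nil =>
    have hbot : Ideal.ofList ([] : List R) • (⊤ : Submodule R M) = ⊥ := by simp
    let E := Submodule.quotEquivOfEqBot _ hbot
    obtain ⟨e', he'⟩ := hi (Abelian.Ext.mk₀ (ModuleCat.ofHom (E.toLinearMap ∘ₗ f)))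
    obtain ⟨g, rfl⟩ := (Abelian.Ext.mk₀_bijective B M).2 e'
    rw [Abelian.Ext.mk₀_comp_mk₀] at he'
    have := (Abelian.Ext.mk₀_bijective A M).1 he'
    refine ⟨E.symm.toLinearMap ∘ₗ g.hom, ?_⟩
    ext a
    have := congr(E.symm ($this a))
    simpa using! this
  | cons x xs ih =>
    rw [isWeaklyRegular_cons_iff] at h
    have hS := h.1.smulShortComplex_shortExact
    let E := Submodule.quotOfListConsSMulTopEquivQuotSMulTopInner M x xs
    have := ext_subsingleton_of_isWeaklyRegular (rs := x :: xs)
      ((isWeaklyRegular_cons_iff M x xs).2 h) hA (j := xs.length) (by simp)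
    obtain ⟨g, hg⟩ := ih (M := (M.smulShortComplex x).X₃) h.2 (fun r hr ↦ hA r (by simp [hr]))
      (fun r hr ↦ hB r (by simp [hr])) (fun e ↦ by
        obtain ⟨v, hv⟩ := hi (e.comp hS.extClass rfl)
        obtain ⟨w, rfl⟩ := exists_comp_extClass_eq_of_mem_annihilator h.1 (hB x (by simp)) v
        refine ⟨w, ?_⟩
        rw [← sub_eq_zero]
        obtain ⟨y, hy⟩ := Abelian.Ext.covariant_sequence_exact₃ A hS
          ((Abelian.Ext.mk₀ i).comp w (zero_add _) - e) rfl (by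
            refine (map_sub (hS.extClass.postcomp A (by rfl)) _ _).trans ?_
            rw [sub_eq_zero]
            exact (Abelian.Ext.comp_assoc _ _ _ _ _ (by lia)).trans hv)
        rw [← hy, show y = 0 from @Subsingleton.elim _ this y 0]
        exact Abelian.Ext.zero_comp _ _ _ _ _) (E.toLinearMap ∘ₗ f)
    refine ⟨E.symm.toLinearMap ∘ₗ g, ?_⟩
    ext a
    exact E.injective ((E.apply_symm_apply _).trans (DFunLike.congr_fun hg a))

/-- If `Ext A M i` vanishes for `i > 0` and `rs` is weakly regular on `M`, then maps
`A → M / rs M` lift to `M`. -/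
lemma exists_lift_of_ext_subsingleton {rs : List R} {M A : ModuleCat.{u} R}
    (h : IsWeaklyRegular M rs) (hA : ∀ i, 0 < i → Subsingleton (Abelian.Ext A M i))
    (f : A →ₗ[R] M ⧸ (Ideal.ofList rs • (⊤ : Submodule R M))) :
    ∃ g : A →ₗ[R] M, Submodule.mkQ _ ∘ₗ g = f := by
  induction rs generalizing M with
  | nil =>
    have hbot : Ideal.ofList ([] : List R) • (⊤ : Submodule R M) = ⊥ := by simp
    let E := Submodule.quotEquivOfEqBot _ hbot
    refine ⟨E.toLinearMap ∘ₗ f, ?_⟩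
    ext a
    exact E.symm_apply_apply (f a)
  | cons x xs ih =>
    rw [isWeaklyRegular_cons_iff] at h
    have hS := h.1.smulShortComplex_shortExact
    let E := Submodule.quotOfListConsSMulTopEquivQuotSMulTopInner M x xs
    obtain ⟨g, hg⟩ := ih (M := (M.smulShortComplex x).X₃) h.2 (fun i hi ↦
      subsingleton_of_forall_eq 0 fun e ↦ by
        have h1 : Subsingleton (Abelian.Ext A (M.smulShortComplex x).X₁ (i + 1)) := hA _ (by lia)
        have h2 : Subsingleton (Abelian.Ext A (M.smulShortComplex x).X₂ i) := hA _ hi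
        obtain ⟨y, rfl⟩ := Abelian.Ext.covariant_sequence_exact₃ A hS e rfl
          (Subsingleton.elim _ _)
        rw [Subsingleton.elim y 0, Abelian.Ext.zero_comp]) (E.toLinearMap ∘ₗ f)
    have h1 : Subsingleton (Abelian.Ext A (M.smulShortComplex x).X₁ 1) := hA _ (by lia)
    obtain ⟨y, hy⟩ := Abelian.Ext.covariant_sequence_exact₃ A hS
      (Abelian.Ext.mk₀ (ModuleCat.ofHom g : A ⟶ (M.smulShortComplex x).X₃)) rfl
      (Subsingleton.elim _ _)
    obtain ⟨g', rfl⟩ := (Abelian.Ext.mk₀_bijective A _).2 y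
    rw [Abelian.Ext.mk₀_comp_mk₀] at hy
    have hy := (Abelian.Ext.mk₀_bijective A _).1 hy
    refine ⟨g'.hom, ?_⟩
    ext a
    apply E.injective
    have h3 : E (f a) = Submodule.Quotient.mk (g a) := (DFunLike.congr_fun hg a).symm
    have h4 : g a = Submodule.Quotient.mk (g'.hom a) := (congr($hy a)).symm
    rw [h3, h4]
    rfl

lemma ext_subsingleton_of_iso {A B M : ModuleCat.{u} R} (i : A ≅ B) {n : ℕ}
    [Subsingleton (Abelian.Ext A M n)] : Subsingleton (Abelian.Ext B M n) := by
  refine subsingleton_of_forall_eq 0 fun e ↦ ?_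
  have h : (Abelian.Ext.mk₀ i.inv).comp ((Abelian.Ext.mk₀ i.hom).comp e (zero_add n))
      (zero_add n) = e := by
    rw [Abelian.Ext.mk₀_comp_mk₀_assoc, i.inv_hom_id, Abelian.Ext.mk₀_id_comp]
  rw [← h, Subsingleton.elim ((Abelian.Ext.mk₀ i.hom).comp e (zero_add n)) 0,
    Abelian.Ext.comp_zero]

/-- Quotienting by a weakly regular sequence raises the vanishing bound for `Ext _ M` by at most
its length. -/
lemma ext_quotient_subsingleton {rs : List R} {M A : ModuleCat.{u} R}
    (h : IsWeaklyRegular A rs) {c : ℕ} (hA : ∀ i, c < i → Subsingleton (Abelian.Ext A M i))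
    {i : ℕ} (hi : c + rs.length < i) :
    Subsingleton (Abelian.Ext
      (ModuleCat.of R (A ⧸ (Ideal.ofList rs • (⊤ : Submodule R A)))) M i) := by
  induction rs generalizing A c with
  | nil =>
    have hbot : Ideal.ofList ([] : List R) • (⊤ : Submodule R A) = ⊥ := by simp
    have := hA i (by simpa using hi)
    exact ext_subsingleton_of_iso (Submodule.quotEquivOfEqBot _ hbot).toModuleIso.symm
  | cons x xs ih =>
    rw [isWeaklyRegular_cons_iff] at h
    have hS := h.1.smulShortComplex_shortExact
    have : Subsingleton (Abelian.Ext (ModuleCat.of R (QuotSMulTop x A ⧸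
        Ideal.ofList xs • (⊤ : Submodule R (QuotSMulTop x A)))) M i) :=
      ih (A := (A.smulShortComplex x).X₃) (c := c + 1) h.2 (fun i hi ↦
      subsingleton_of_forall_eq 0 fun e ↦ by
        obtain ⟨i, rfl⟩ := Nat.exists_eq_add_of_lt (Nat.pos_of_ne_zero (by lia : i ≠ 0))
        have h1 : Subsingleton (Abelian.Ext (A.smulShortComplex x).X₁ M i) := hA _ (by lia)
        have h2 : Subsingleton (Abelian.Ext (A.smulShortComplex x).X₂ M (0 + i + 1)) :=
          hA _ (by lia)
        obtain ⟨y, rfl⟩ := Abelian.Ext.contravariant_sequence_exact₃ hS M e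
          (Subsingleton.elim _ _) (by lia : 1 + i = 0 + i + 1)
        rw [Subsingleton.elim y 0, Abelian.Ext.comp_zero])
      (by simp only [List.length_cons] at hi; lia)
    exact ext_subsingleton_of_iso
      (Submodule.quotOfListConsSMulTopEquivQuotSMulTopInner A x xs).toModuleIso.symm

section Local

variable [IsLocalRing R] [IsNoetherianRing R]

/-- If `x` is a nonunit regular on `A` and `Ext (A / xA) M i` vanishes for `i > c + 1`, then
`Ext A M i` vanishes for `i > c`. -/
lemma ext_subsingleton_of_smulShortComplex {x : R} (hx : x ∈ IsLocalRing.maximalIdeal R)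
    {M A : ModuleCat.{u} R} [Module.Finite R A] [Module.Finite R M] (h : IsSMulRegular A x)
    {i : ℕ} (hA : Subsingleton (Abelian.Ext (ModuleCat.of R (QuotSMulTop x A)) M (i + 1))) :
    Subsingleton (Abelian.Ext A M i) := by
  have hS := h.smulShortComplex_shortExact
  by_contra hn
  rw [not_subsingleton_iff_nontrivial] at hn
  have hfin : Module.Finite R (Abelian.Ext A M i) := inferInstance
  refine Submodule.top_ne_pointwise_smul_of_mem_jacobson_annihilator (R := R)
    (M := Abelian.Ext A M i) (r := x) ?_ ?_
  · exact IsLocalRing.maximalIdeal_le_jacobson _ hx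
  · refine (eq_top_iff.2 fun e _ ↦ ?_).symm
    obtain ⟨y, hy⟩ := Abelian.Ext.contravariant_sequence_exact₁ hS M (n₁ := i + 1) e
      (by lia) (@Subsingleton.elim _ hA _ _)
    exact ⟨y, trivial, (mk₀_smul_id_comp_ext y x).symm.trans hy⟩

lemma ext_subsingleton_of_quotient {rs : List R}
    (hrs : ∀ r ∈ rs, r ∈ IsLocalRing.maximalIdeal R)
    {M A : ModuleCat.{u} R} [Module.Finite R A] [Module.Finite R M] (h : IsWeaklyRegular A rs)
    {i : ℕ} (hA : Subsingleton (Abelian.Ext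
      (ModuleCat.of R (A ⧸ (Ideal.ofList rs • (⊤ : Submodule R A)))) M (i + rs.length))) :
    Subsingleton (Abelian.Ext A M i) := by
  induction rs generalizing A i with
  | nil =>
    have hbot : Ideal.ofList ([] : List R) • (⊤ : Submodule R A) = ⊥ := by simp
    exact ext_subsingleton_of_iso (Submodule.quotEquivOfEqBot _ hbot).toModuleIso
  | cons x xs ih =>
    rw [isWeaklyRegular_cons_iff] at h
    refine ext_subsingleton_of_smulShortComplex (hrs x (by simp)) h.1
      (ih (fun r hr ↦ hrs r (by simp [hr])) (A := ModuleCat.of R (QuotSMulTop x A)) h.2 ?_)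
    have e := (Submodule.quotOfListConsSMulTopEquivQuotSMulTopInner A x xs).toModuleIso
    rw [show i + 1 + xs.length = i + (x :: xs).length by simp; lia]
    exact ext_subsingleton_of_iso e

end Local

end ExtRegular

section SelfInjDim

open RingTheory.Sequence IsLocalRing

lemma shortExact_of_exact {R : Type u} [CommRing R] {A B C : Type u} [AddCommGroup A]
    [AddCommGroup B] [AddCommGroup C] [Module R A] [Module R B] [Module R C]
    (f : A →ₗ[R] B) (g : B →ₗ[R] C) (hf : Function.Injective f) (hg : Function.Surjective g)
    (h : Function.Exact f g) :
    (ShortComplex.mk (ModuleCat.ofHom f) (ModuleCat.ofHom g)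
      (by rw [← ModuleCat.ofHom_comp, h.linearMap_comp_eq_zero]; rfl)).ShortExact where
  exact := (ShortComplex.ShortExact.moduleCat_exact_iff_function_exact _).2 h
  mono_f := (ModuleCat.mono_iff_injective _).2 hf
  epi_g := (ModuleCat.epi_iff_surjective _).2 hg

variable {S : Type u} [CommRing S] [IsLocalRing S] [IsNoetherianRing S]

variable (S) in
/-- `d` is the injective dimension of the local ring `S` over itself: `Ext M S i` vanishes for
`i > d` and finite `M`, while `Ext k S d` is nonzero for the residue field `k`. -/
def HasSelfInjDim (d : ℕ) : Prop :=
  (∀ (M : ModuleCat.{u} S) [Module.Finite S M] (i : ℕ), d < i →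
    Subsingleton (Abelian.Ext M (ModuleCat.of S S) i)) ∧
  ¬ Subsingleton (Abelian.Ext (ModuleCat.of S (S ⧸ maximalIdeal S)) (ModuleCat.of S S) d)

/-- Under vanishing above `d`, vanishing of `Ext _ S d` on the residue field propagates to all
finite modules. -/
lemma ext_subsingleton_of_residue {d : ℕ}
    (hd : ∀ (M : ModuleCat.{u} S) [Module.Finite S M] (i : ℕ), d < i →
      Subsingleton (Abelian.Ext M (ModuleCat.of S S) i))
    (hk : Subsingleton (Abelian.Ext (ModuleCat.of S (S ⧸ maximalIdeal S)) (ModuleCat.of S S) d))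
    (M : ModuleCat.{u} S) (hM : Module.Finite S M) :
    Subsingleton (Abelian.Ext M (ModuleCat.of S S) d) := by
  refine IsNoetherianRing.induction_on_isQuotientEquivQuotientPrime S (M := M) hM
    (motive := fun N _ _ _ ↦ Subsingleton (Abelian.Ext (ModuleCat.of S N) (ModuleCat.of S S) d))
    ?_ ?_ ?_
  · intro N _ _ _ _
    refine subsingleton_of_forall_eq 0 fun e ↦ ?_
    rw [← one_smul S e]
    exact smul_ext_eq_zero_of_mem_annihilator e
      (Module.mem_annihilator.2 fun _ ↦ Subsingleton.elim _ _)
  · intro N _ _ _ p E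
    by_cases hp : p.1 = maximalIdeal S
    · have := ext_subsingleton_of_iso (M := ModuleCat.of S S) (n := d)
        (E.trans (Submodule.quotEquivOfEq _ _ hp)).toModuleIso.symm
      exact this
    · obtain ⟨x, hx, hxp⟩ := SetLike.exists_of_lt
        (lt_of_le_of_ne (le_maximalIdeal p.2.ne_top) hp)
      refine ext_subsingleton_of_smulShortComplex (A := ModuleCat.of S N) hx ?_ (hd _ _ (by lia))
      refine (E.isSMulRegular_congr x).2 ?_
      intro a b hab
      obtain ⟨a, rfl⟩ := Ideal.Quotient.mk_surjective a
      obtain ⟨b, rfl⟩ := Ideal.Quotient.mk_surjective b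
      change Ideal.Quotient.mk p.1 (x * a) = Ideal.Quotient.mk p.1 (x * b) at hab
      rw [Ideal.Quotient.eq, ← mul_sub] at hab
      exact Ideal.Quotient.eq.2 ((p.2.mem_or_mem hab).resolve_left hxp)
  · intro N₁ _ _ _ N₂ _ _ _ N₃ _ _ _ f g hf hg h h₁ h₃
    refine subsingleton_of_forall_eq 0 fun e ↦ ?_
    obtain ⟨y, rfl⟩ := Abelian.Ext.contravariant_sequence_exact₂
      (shortExact_of_exact f g hf hg h) _ e (Subsingleton.elim _ _)
    rw [Subsingleton.elim y 0, Abelian.Ext.comp_zero]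

lemma exists_hasSelfInjDim {n : ℕ} (hn : ∀ (M : ModuleCat.{u} S) (i : ℕ), n < i →
    Subsingleton (Abelian.Ext M (ModuleCat.of S S) i)) : ∃ d, HasSelfInjDim S d := by
  classical
  have hex : ∃ d, ∀ (M : ModuleCat.{u} S) [Module.Finite S M] (i : ℕ), d < i →
    Subsingleton (Abelian.Ext M (ModuleCat.of S S) i) := ⟨n, fun M _ i hi ↦ hn M i hi⟩
  refine ⟨Nat.find hex, Nat.find_spec hex, fun hk ↦ ?_⟩
  have key := ext_subsingleton_of_residue (Nat.find_spec hex) hk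
  rcases hd : Nat.find hex with _ | d
  · have h0 := key (ModuleCat.of S S) inferInstance
    rw [hd] at h0
    have h1 := (Abelian.Ext.mk₀_bijective (ModuleCat.of S S) (ModuleCat.of S S)).1
      (Subsingleton.elim (Abelian.Ext.mk₀ (𝟙 _)) (Abelian.Ext.mk₀ 0))
    have h2 := congr($h1 (1 : S))
    exact one_ne_zero (α := S) h2
  · refine Nat.find_min hex (m := d) (by lia) fun M _ i hi ↦ ?_
    obtain rfl | hi := (Nat.succ_le_of_lt hi).eq_or_lt
    · have := key M inferInstance
      rwa [hd] at this
    · exact Nat.find_spec hex M i (by lia)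

lemma ext_surjective_of_injective {R : Type u} [CommRing R] {A B C : ModuleCat.{u} R} {d : ℕ}
    (f : A →ₗ[R] B) (hf : Function.Injective f)
    (h : Subsingleton (Abelian.Ext (ModuleCat.of R (B ⧸ LinearMap.range f)) C (d + 1)))
    (e : Abelian.Ext A C d) :
    ∃ e' : Abelian.Ext B C d, (Abelian.Ext.mk₀ (ModuleCat.ofHom f)).comp e' (zero_add _) = e :=
  Abelian.Ext.contravariant_sequence_exact₁
    (shortExact_of_exact f (Submodule.mkQ (LinearMap.range f)) hf (Submodule.mkQ_surjective _)
      (LinearMap.exact_map_mkQ_range f)) C (n₁ := d + 1) e (by lia) (Subsingleton.elim _ _)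

namespace HasSelfInjDim

variable {d : ℕ}

lemma exists_isWeaklyRegular (hS : HasSelfInjDim S d) (k : ℕ) {t : ℕ} (ht : t ≤ d) :
    ∃ rs : List S, rs.length = t ∧ (∀ r ∈ rs, r ∈ maximalIdeal S ^ k) ∧ IsWeaklyRegular S rs := by
  induction t with
  | zero => exact ⟨[], rfl, by simp, .nil S S⟩
  | succ t ih =>
    obtain ⟨rs, hlen, hmem, hreg⟩ := ih (by lia)
    let Q := S ⧸ (Ideal.ofList rs • (⊤ : Submodule S S))
    by_cases hQ : Subsingleton ((S ⧸ maximalIdeal S) →ₗ[S] Q)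
    · obtain ⟨r, hr, hreg'⟩ := IsSMulRegular.subsingleton_linearMap_iff.1 hQ
      rw [Ideal.annihilator_quotient] at hr
      refine ⟨rs ++ [r ^ k], by simp [hlen], ?_, ?_⟩
      · simp only [List.mem_append, List.mem_singleton]
        rintro x (hx | rfl)
        exacts [hmem x hx, Ideal.pow_mem_pow hr k]
      · exact (isWeaklyRegular_append_iff ..).2
          ⟨hreg, (isWeaklyRegular_singleton_iff ..).2 (hreg'.pow k)⟩
    · exfalso
      rw [not_subsingleton_iff_nontrivial] at hQ
      obtain ⟨φ, hφ⟩ := exists_ne (0 : (S ⧸ maximalIdeal S) →ₗ[S] Q)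
      have : IsSimpleModule S (S ⧸ maximalIdeal S) :=
        isSimpleModule_iff_isCoatom.2 (maximalIdeal.isMaximal S).1
      have hφ := LinearMap.injective_of_ne_zero hφ
      refine hS.2 (subsingleton_of_forall_eq 0 fun e ↦ ?_)
      obtain ⟨e', rfl⟩ := ext_surjective_of_injective (A := ModuleCat.of S (S ⧸ maximalIdeal S))
        (B := ModuleCat.of S Q) (C := ModuleCat.of S S) φ hφ (hS.1 _ _ (by lia)) e
      have := ext_quotient_subsingleton (M := ModuleCat.of S S)
        (A := ModuleCat.of S S) hreg (c := 0)
        (fun i hi ↦ subsingleton_of_forall_eq 0 fun e ↦ by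
          obtain ⟨i, rfl⟩ := Nat.exists_eq_add_of_lt hi
          exact Abelian.Ext.eq_zero_of_projective e) (i := d) (by lia)
      rw [@Subsingleton.elim _ this e' 0, Abelian.Ext.comp_zero]

/-- Modulo a maximal regular sequence, `S` is self-injective. -/
lemma exists_extension {S : Type u} [CommRing S] [IsLocalRing S] (hS : HasSelfInjDim S d)
    {rs : List S} (hlen : rs.length = d) (hreg : IsWeaklyRegular S rs) {A B : Type u} [AddCommGroup A] [AddCommGroup B]
    [Module S A] [Module S B] [Module.Finite S B]
    (hB : ∀ r ∈ rs, r ∈ Module.annihilator S B) (i : A →ₗ[S] B) (hi : Function.Injective i)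
    (f : A →ₗ[S] S ⧸ (Ideal.ofList rs • (⊤ : Submodule S S))) :
    ∃ g : B →ₗ[S] S ⧸ (Ideal.ofList rs • (⊤ : Submodule S S)), g ∘ₗ i = f := by
  subst hlen
  exact exists_extension_of_ext_surjective (M := ModuleCat.of S S) hreg
    (A := ModuleCat.of S A) (B := ModuleCat.of S B) (ModuleCat.ofHom i)
    (fun r hr ↦ LinearMap.annihilator_le_of_injective i hi (hB r hr)) hB
    (ext_surjective_of_injective (A := ModuleCat.of S A) (B := ModuleCat.of S B) i hi
      (hS.1 _ _ (by lia))) f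

lemma ext_subsingleton (hS : HasSelfInjDim S d) {rs : List S} (hlen : rs.length = d)
    (hmem : ∀ r ∈ rs, r ∈ maximalIdeal S) {A : ModuleCat.{u} S} [Module.Finite S A]
    (hA : IsWeaklyRegular A rs) {i : ℕ} (hi : 0 < i) :
    Subsingleton (Abelian.Ext A (ModuleCat.of S S) i) :=
  ext_subsingleton_of_quotient hmem hA (hS.1 _ _ (by lia))

/-- Elements outside `rs A` are detected modulo `rs` by linear forms on `A`. -/
lemma exists_linearMap_notMem (hS : HasSelfInjDim S d) {rs : List S} (hlen : rs.length = d)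
    (hmem : ∀ r ∈ rs, r ∈ maximalIdeal S) (hreg : IsWeaklyRegular S rs)
    {A : Type u} [AddCommGroup A] [Module S A] [Module.Finite S A] (hA : IsWeaklyRegular A rs)
    {a : A} (ha : a ∉ Ideal.ofList rs • (⊤ : Submodule S A)) :
    ∃ l : A →ₗ[S] S, l a ∉ Ideal.ofList rs • (⊤ : Submodule S S) := by
  have hk := hS.2
  rw [not_subsingleton_iff_nontrivial] at hk
  obtain ⟨e, he⟩ := exists_ne
    (0 : Abelian.Ext (ModuleCat.of S (S ⧸ maximalIdeal S)) (ModuleCat.of S S) d)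
  obtain ⟨φ, hφ⟩ : ∃ φ : (S ⧸ maximalIdeal S) →ₗ[S] S ⧸ (Ideal.ofList rs • (⊤ : Submodule S S)),
      φ ≠ 0 := by
    subst hlen
    refine exists_linearMap_ne_zero_of_ext_ne_zero (M := ModuleCat.of S S) hreg
      (A := ModuleCat.of S (S ⧸ maximalIdeal S)) (fun r hr ↦ ?_) e he
    exact (Ideal.annihilator_quotient (I := maximalIdeal S)).symm ▸ hmem r hr
  have hφ1 : φ (Submodule.Quotient.mk 1) ≠ 0 := fun h0 ↦ hφ (by
    ext
    simpa using! h0)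
  let B := A ⧸ (Ideal.ofList rs • (⊤ : Submodule S A))
  let b : B := Submodule.Quotient.mk a
  have hb : b ≠ 0 := fun h ↦ ha ((Submodule.Quotient.mk_eq_zero _).1 h)
  have htor : Ideal.torsionOf S B b ≤ maximalIdeal S :=
    le_maximalIdeal (fun h ↦ hb ((Ideal.torsionOf_eq_top_iff S b).1 h))
  let E := Ideal.quotTorsionOfEquivSpanSingleton S B b
  obtain ⟨g, hg⟩ := hS.exists_extension hlen hreg (A := Submodule.span S {b}) (B := B)
    (fun r hr ↦ Module.mem_annihilator.2 fun x ↦ by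
      obtain ⟨x, rfl⟩ := Submodule.Quotient.mk_surjective _ x
      rw [← Submodule.Quotient.mk_smul, Submodule.Quotient.mk_eq_zero]
      exact Submodule.smul_mem_smul (Ideal.subset_span hr) trivial)
    (Submodule.subtype _) (Submodule.injective_subtype _)
    (φ ∘ₗ Submodule.factor htor ∘ₗ E.symm.toLinearMap)
  have hgb : g b = φ (Submodule.Quotient.mk 1) := by
    have hE : E (Submodule.Quotient.mk 1) = ⟨b, Submodule.mem_span_singleton_self b⟩ := by
      ext
      exact one_smul S b
    have := DFunLike.congr_fun hg (E (Submodule.Quotient.mk 1))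
    simp only [LinearMap.comp_apply, LinearEquiv.coe_coe, LinearEquiv.symm_apply_apply] at this
    rw [hE] at this
    exact this
  obtain ⟨l, hl⟩ := exists_lift_of_ext_subsingleton (M := ModuleCat.of S S) (A := ModuleCat.of S A)
    hreg (fun i hi ↦ hS.ext_subsingleton hlen hmem (A := ModuleCat.of S A) hA hi)
    (g ∘ₗ Submodule.mkQ _)
  refine ⟨l, fun h ↦ hφ1 ?_⟩
  rw [← hgb]
  exact (DFunLike.congr_fun hl a).symm.trans ((Submodule.Quotient.mk_eq_zero _).2 h)

end HasSelfInjDim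

/-- Powers of a regular sequence form a regular sequence. -/
lemma isWeaklyRegular_map_pow {M : Type u} [AddCommGroup M] [Module S M] [Module.Finite S M]
    {rs : List S} (hmem : ∀ r ∈ rs, r ∈ maximalIdeal S) (h : IsWeaklyRegular M rs) {a : ℕ}
    (ha : a ≠ 0) :
    IsWeaklyRegular M (rs.map (· ^ a)) := by
  induction rs generalizing M with
  | nil => exact .nil S M
  | cons x xs ih =>
    have hx : x ∈ maximalIdeal S := hmem x (by simp)
    have hxs : ∀ r ∈ xs, r ∈ maximalIdeal S := fun r hr ↦ hmem r (by simp [hr])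
    have hpow : ∀ r ∈ xs.map (· ^ a), r ∈ maximalIdeal S := by
      simp only [List.mem_map]
      rintro _ ⟨r, hr, rfl⟩
      exact Ideal.pow_mem_of_mem _ (hxs r hr) _ (Nat.pos_of_ne_zero ha)
    rw [isWeaklyRegular_cons_iff] at h
    have h1 : IsWeaklyRegular M (x :: xs.map (· ^ a)) :=
      (isWeaklyRegular_cons_iff ..).2 ⟨h.1, ih hxs h.2⟩
    have h2 := isWeaklyRegular_of_perm_of_subset_maximalIdeal h1
      (List.perm_append_singleton x _).symm (by
        simp only [List.mem_cons]
        rintro r (rfl | hr)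
        exacts [hx, hpow r hr])
    rw [isWeaklyRegular_append_iff, isWeaklyRegular_singleton_iff] at h2
    have h3 : IsWeaklyRegular M (xs.map (· ^ a) ++ [x ^ a]) := by
      rw [isWeaklyRegular_append_iff, isWeaklyRegular_singleton_iff]
      exact ⟨h2.1, h2.2.pow a⟩
    refine isWeaklyRegular_of_perm_of_subset_maximalIdeal h3
      (List.perm_append_singleton (x ^ a) _) ?_
    simp only [List.mem_append, List.mem_singleton]
    rintro r (hr | rfl)
    exacts [hpow r hr, Ideal.pow_mem_of_mem _ hx _ (Nat.pos_of_ne_zero ha)]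

end SelfInjDim

section Core

open RingTheory.Sequence IsLocalRing

lemma ofList_map_algebraMap_smul_top {S T F : Type u} [CommRing S] [CommRing T] [Algebra S T]
    [AddCommGroup F] [Module S F] [Module T F] [IsScalarTower S T F] (rs : List S) (x : F) :
    x ∈ Ideal.ofList (rs.map (algebraMap S T)) • (⊤ : Submodule T F) ↔
      x ∈ Ideal.ofList rs • (⊤ : Submodule S F) := by
  rw [← Ideal.map_ofList, ← Submodule.restrictScalars_mem S, Ideal.smul_restrictScalars]
  rfl

variable {S T : Type u} [CommRing S] [IsLocalRing S] [IsNoetherianRing S]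
  [CommRing T] [IsLocalRing T] [Algebra S T] [Module.Finite S T]
  {d : ℕ} {K F : Type u} [AddCommGroup K] [AddCommGroup F] [Module T K] [Module T F]
  [Module.Finite T F] [Module.Free T F] [Module S F] [IsScalarTower S T F]

/-- Approximate version of `exists_extension_of_forall_linearMap`. -/
lemma exists_extension_modulo_pow (hS : HasSelfInjDim S d) (hT : HasSelfInjDim T d)
    (hloc : ∀ s ∈ maximalIdeal S, algebraMap S T s ∈ maximalIdeal T)
    (hreg : ∀ rs : List S, (∀ r ∈ rs, r ∈ maximalIdeal S) → IsWeaklyRegular S rs →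
      IsWeaklyRegular T rs)
    (j : K →ₗ[T] F) (g : K →ₗ[T] T)
    (h : ∀ l : T →ₗ[S] S, ∃ G : F →ₗ[S] S, ∀ a, G (j a) = l (g a)) (k : ℕ) :
    ∃ G : F →ₗ[T] T, ∀ a, g a - G (j a) ∈ maximalIdeal T ^ k := by
  obtain ⟨rs, hlen, hmem, hrs⟩ := hS.exists_isWeaklyRegular (k + 1) le_rfl
  have hmem' : ∀ r ∈ rs, r ∈ maximalIdeal S := fun r hr ↦ Ideal.pow_le_self (by lia) (hmem r hr)
  let rs' := rs.map (algebraMap S T)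
  have hrs' : IsWeaklyRegular T rs' :=
    (isWeaklyRegular_map_algebraMap_iff T T rs).2 (hreg rs hmem' hrs)
  have hle : Ideal.ofList rs' • (⊤ : Submodule T T) ≤ maximalIdeal T ^ k := by
    rw [smul_eq_mul, Ideal.mul_top, Ideal.ofList, Ideal.span_le]
    intro x hx
    obtain ⟨r, hr, rfl⟩ := List.mem_map.1 hx
    refine Ideal.pow_le_pow_right (Nat.le_succ k) ?_
    have : (maximalIdeal S ^ (k + 1)).map (algebraMap S T) ≤ maximalIdeal T ^ (k + 1) := by
      rw [Ideal.map_pow]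
      exact Ideal.pow_right_mono (Ideal.map_le_iff_le_comap.2 hloc) _
    exact this (Ideal.mem_map_of_mem _ (hmem r hr))
  let B := F ⧸ (Ideal.ofList rs' • (⊤ : Submodule T F))
  let q : K →ₗ[T] B := Submodule.mkQ _ ∘ₗ j
  let g' : K →ₗ[T] T ⧸ (Ideal.ofList rs' • (⊤ : Submodule T T)) := Submodule.mkQ _ ∘ₗ g
  have hker : LinearMap.ker q ≤ LinearMap.ker g' := by
    intro a ha
    have ha : j a ∈ Ideal.ofList rs' • (⊤ : Submodule T F) := (Submodule.Quotient.mk_eq_zero _).1 ha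
    refine (Submodule.Quotient.mk_eq_zero _).2 ?_
    rw [ofList_map_algebraMap_smul_top] at ha ⊢
    by_contra hga
    obtain ⟨l, hl⟩ := hS.exists_linearMap_notMem hlen hmem' hrs (hreg rs hmem' hrs) hga
    obtain ⟨G, hG⟩ := h l
    refine hl ?_
    rw [← hG]
    have := Submodule.mem_map_of_mem (f := G) ha
    rw [Submodule.map_smul''] at this
    exact Submodule.smul_mono le_rfl le_top this
  obtain ⟨G, hG⟩ := hT.exists_extension (rs := rs') (by simpa [rs'] using hlen) hrs' (B := B)
    (fun r hr ↦ Module.mem_annihilator.2 fun x ↦ by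
      obtain ⟨x, rfl⟩ := Submodule.Quotient.mk_surjective _ x
      rw [← Submodule.Quotient.mk_smul, Submodule.Quotient.mk_eq_zero]
      exact Submodule.smul_mem_smul (Ideal.subset_span hr) trivial)
    (LinearMap.range q).subtype (Submodule.injective_subtype _)
    ((LinearMap.ker q).liftQ g' hker ∘ₗ q.quotKerEquivRange.symm.toLinearMap)
  obtain ⟨G', hG'⟩ := Module.projective_lifting_property
    (Submodule.mkQ (Ideal.ofList rs' • (⊤ : Submodule T T)))
    (G ∘ₗ Submodule.mkQ _) (Submodule.mkQ_surjective _)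
  refine ⟨G', fun a ↦ hle ?_⟩
  rw [← Submodule.Quotient.eq]
  have h1 := DFunLike.congr_fun hG (q.quotKerEquivRange (Submodule.Quotient.mk a))
  simp only [LinearMap.comp_apply, LinearEquiv.coe_coe, LinearEquiv.symm_apply_apply] at h1
  exact h1.symm.trans (DFunLike.congr_fun hG' (j a)).symm

/-- A `T`-linear form on `K` extends along `j : K → F` as soon as its compositions with all
`S`-linear maps `T → S` do. -/
theorem exists_extension_of_forall_linearMap [IsNoetherianRing T] [Module.Finite T K]
    (hS : HasSelfInjDim S d) (hT : HasSelfInjDim T d)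
    (hloc : ∀ s ∈ maximalIdeal S, algebraMap S T s ∈ maximalIdeal T)
    (hreg : ∀ rs : List S, (∀ r ∈ rs, r ∈ maximalIdeal S) → IsWeaklyRegular S rs →
      IsWeaklyRegular T rs)
    (j : K →ₗ[T] F) (g : K →ₗ[T] T)
    (h : ∀ l : T →ₗ[S] S, ∃ G : F →ₗ[S] S, ∀ a, G (j a) = l (g a)) :
    ∃ G : F →ₗ[T] T, G ∘ₗ j = g := by
  obtain ⟨b, x, hx⟩ := Module.Finite.exists_fin (R := T) (M := K)
  let ev : (K →ₗ[T] T) →ₗ[T] (Fin b → T) := LinearMap.pi fun i ↦ LinearMap.applyₗ (x i)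
  let L : Submodule T (Fin b → T) := LinearMap.range (ev ∘ₗ LinearMap.lcomp T T j)
  have hmem : ev g ∈ L := by
    rw [← Submodule.Quotient.mk_eq_zero, ← Submodule.mem_bot T,
      ← Ideal.iInf_pow_smul_eq_bot_of_isLocalRing (maximalIdeal T)
        (maximalIdeal.isMaximal T).ne_top,
      Submodule.mem_iInf]
    intro k
    obtain ⟨G, hG⟩ := exists_extension_modulo_pow hS hT hloc hreg j g h k
    have h1 : (Submodule.Quotient.mk (ev g) : (Fin b → T) ⧸ L) =
        Submodule.mkQ L (ev (g - G ∘ₗ j)) := by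
      refine (Submodule.Quotient.eq L).2 ⟨G, ?_⟩
      simp [LinearMap.lcomp_apply']
    have h2 : ev (g - G ∘ₗ j) ∈ maximalIdeal T ^ k • (⊤ : Submodule T (Fin b → T)) := by
      rw [pi_eq_sum_univ (ev (g - G ∘ₗ j))]
      exact Submodule.sum_mem _ fun i _ ↦ Submodule.smul_mem_smul (hG (x i)) trivial
    rw [h1]
    have := Submodule.mem_map_of_mem (f := L.mkQ) h2
    rw [Submodule.map_smul''] at this
    exact Submodule.smul_mono le_rfl le_top this
  obtain ⟨G, hG⟩ := hmem
  refine ⟨G, LinearMap.ext_on_range hx fun i ↦ congr_fun hG i⟩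

end Core

section Localize

lemma exists_localized_lift {A : Type u} [CommRing A] (W : Submonoid A) {K X : Type u}
    [AddCommGroup K] [AddCommGroup X] [Module A K] [Module A X] [Module (Localization W) X]
    [IsScalarTower A (Localization W) X] (h : K →ₗ[A] X) :
    ∃ h' : LocalizedModule W K →ₗ[Localization W] X,
      ∀ a, h' (LocalizedModule.mkLinearMap W K a) = h a := by
  have hu : ∀ s : W, IsUnit (algebraMap A (Module.End A X) s) := fun s ↦ by
    obtain ⟨u, hu⟩ := IsLocalization.map_units (Localization W) s
    refine (Module.End.isUnit_iff _).2 ?_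
    convert! MulAction.bijective (β := X) u using 1
    ext x
    rw [Units.smul_def, hu, algebraMap_smul]
    rfl
  refine ⟨(IsLocalizedModule.lift W (LocalizedModule.mkLinearMap W K) h
    hu).extendScalarsOfIsLocalization W (Localization W), fun a ↦ ?_⟩
  exact IsLocalizedModule.lift_apply W (LocalizedModule.mkLinearMap W K) h hu a

/-- If the localization of `g` extends along `j`, then so does a multiple of `g`. -/
lemma exists_extension_smul {A : Type u} [CommRing A] [IsNoetherianRing A] (W : Submonoid A)
    {K F : Type u} [AddCommGroup K] [AddCommGroup F] [Module A K] [Module A F] [Module.Finite A K]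
    [Module.Finite A F] (j : K →ₗ[A] F) (g : K →ₗ[A] A) (G : F →ₗ[A] Localization W)
    (hG : ∀ a, G (j a) = algebraMap A (Localization W) (g a)) :
    ∃ s ∈ W, ∃ G' : F →ₗ[A] A, G' ∘ₗ j = s • g := by
  have := Module.finitePresentation_of_finite A F
  obtain ⟨G₁, s₁, h₁⟩ := Module.FinitePresentation.exists_lift_of_isLocalizedModule W
    (Algebra.linearMap A (Localization W)) G
  obtain ⟨s₂, h₂⟩ := Module.Finite.exists_smul_of_comp_eq_of_isLocalizedModule W
    (Algebra.linearMap A (Localization W)) (G₁ ∘ₗ j) (s₁ • g) (by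
      ext a
      have := DFunLike.congr_fun h₁ (j a)
      simp only [LinearMap.comp_apply, LinearMap.smul_apply, hG] at this
      simpa [Submonoid.smul_def, Algebra.smul_def] using this)
  exact ⟨s₂ * s₁, W.mul_mem s₂.2 s₁.2, (s₂ : A) • G₁, by
    rw [mul_smul]
    exact h₂⟩

open IsLocalRing RingTheory.Sequence

variable {R R' : Type u} [CommRing R] [IsNoetherianRing R] [CommRing R'] [IsNoetherianRing R']
  [Algebra R R'] [Module.Finite R R'] {P : Ideal R} [P.IsPrime] {P' : Ideal R'} [P'.IsPrime]
  [Algebra (Localization.AtPrime P) (Localization.AtPrime P')]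
  [IsScalarTower R (Localization.AtPrime P) (Localization.AtPrime P')]
  [Module.Finite (Localization.AtPrime P) (Localization.AtPrime P')] {d : ℕ}

/-- The comparison of linear forms over `R` and over `R'` near `P` and `P'`. -/
theorem exists_linearMap_forall_not_extension
    (hS : HasSelfInjDim (Localization.AtPrime P) d) (hT : HasSelfInjDim (Localization.AtPrime P') d)
    (hloc : ∀ s ∈ maximalIdeal (Localization.AtPrime P),
      algebraMap _ (Localization.AtPrime P') s ∈ maximalIdeal (Localization.AtPrime P'))
    (hreg : ∀ rs : List (Localization.AtPrime P),
      (∀ r ∈ rs, r ∈ maximalIdeal (Localization.AtPrime P)) →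
      IsWeaklyRegular (Localization.AtPrime P) rs → IsWeaklyRegular (Localization.AtPrime P') rs)
    [IsLocalizedModule P.primeCompl
      (IsScalarTower.toAlgHom R R' (Localization.AtPrime P')).toLinearMap]
    (hden : ∀ s' ∈ P'.primeCompl, ∃ t' : R', ∃ s ∈ P.primeCompl, t' * s' = algebraMap R R' s)
    {K : Type u} [AddCommGroup K] [Module R' K] [Module.Finite R' K] {b : ℕ}
    (j : K →ₗ[R'] (Fin b → R')) (g : K →ₗ[R'] R')
    (hg : ∀ s' ∉ P', ∀ G : (Fin b → R') →ₗ[R'] R', G ∘ₗ j ≠ s' • g) :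
    ∃ l : R' →ₗ[R] R, ∀ s ∉ P, ∀ G : (Fin b → R') →ₗ[R] R, ∃ a, G (j a) ≠ s * l (g a) := by
  let S := Localization.AtPrime P
  let T := Localization.AtPrime P'
  let K' := LocalizedModule P'.primeCompl K
  let ι : (Fin b → R') →ₗ[R'] (Fin b → T) := LinearMap.pi fun i ↦
    Algebra.linearMap R' T ∘ₗ LinearMap.proj i
  obtain ⟨j', hj'⟩ := exists_localized_lift P'.primeCompl (X := Fin b → T) (ι ∘ₗ j)
  obtain ⟨g', hg'⟩ := exists_localized_lift P'.primeCompl (X := T) (Algebra.linearMap R' T ∘ₗ g)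
  have : Module.Finite T K' := Module.Finite.of_isLocalizedModule P'.primeCompl
    (LocalizedModule.mkLinearMap P'.primeCompl K)
  by_contra! hcon
  obtain ⟨G', hG'⟩ := exists_extension_of_forall_linearMap (K := K') hS hT hloc hreg j' g' (by
    intro l
    have := Module.finitePresentation_of_finite R R'
    obtain ⟨l₀, s₀, hl₀⟩ := Module.FinitePresentation.exists_lift_of_isLocalizedModule P.primeCompl
      (Algebra.linearMap R S)
      (l.restrictScalars R ∘ₗ (IsScalarTower.toAlgHom R R' T).toLinearMap)
    have hl₀ : ∀ x, algebraMap R S (l₀ x) = algebraMap R S s₀ * l (algebraMap R' T x) := fun x ↦ by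
      simpa [Submonoid.smul_def, Algebra.smul_def] using DFunLike.congr_fun hl₀ x
    obtain ⟨s, hs, G, hG⟩ := hcon l₀
    obtain ⟨u, hu⟩ : IsUnit (algebraMap R S s * algebraMap R S s₀) :=
      (IsLocalization.map_units S (⟨s, hs⟩ : P.primeCompl)).mul (IsLocalization.map_units S s₀)
    let Gi (i : Fin b) : T →ₗ[S] S := (IsLocalizedModule.map P.primeCompl
      (IsScalarTower.toAlgHom R R' T).toLinearMap (Algebra.linearMap R S)
      (G ∘ₗ LinearMap.single R (fun _ ↦ R') i)).extendScalarsOfIsLocalization P.primeCompl S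
    have hGi (i : Fin b) (x : R') : Gi i (algebraMap R' T x) =
        algebraMap R S (G (Pi.single i x)) :=
      IsLocalizedModule.map_apply P.primeCompl (IsScalarTower.toAlgHom R R' T).toLinearMap
        (Algebra.linearMap R S) (G ∘ₗ LinearMap.single R (fun _ ↦ R') i) x
    let H : (Fin b → T) →ₗ[S] S := ∑ i, Gi i ∘ₗ LinearMap.proj i
    have hH (x : Fin b → R') : H (ι x) = algebraMap R S (G x) := by
      have : G x = ∑ i, G (Pi.single i (x i)) := by
        rw [← map_sum, Finset.univ_sum_single]
      rw [this, map_sum]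
      simp only [H, LinearMap.sum_apply]
      exact Finset.sum_congr rfl fun i _ ↦ hGi i (x i)
    refine ⟨(↑u⁻¹ : S) • H, fun a ↦ ?_⟩
    have key (k : K) : (↑u⁻¹ : S) • H (j' (LocalizedModule.mkLinearMap P'.primeCompl K k)) =
        l (g' (LocalizedModule.mkLinearMap P'.primeCompl K k)) := by
      rw [hj', hg', LinearMap.comp_apply, hH, hG, map_mul, LinearMap.comp_apply,
        Algebra.linearMap_apply, hl₀, smul_eq_mul, Units.inv_mul_eq_iff_eq_mul, hu, mul_assoc]
    obtain ⟨⟨k, s'⟩, hk⟩ := IsLocalizedModule.surj P'.primeCompl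
      (LocalizedModule.mkLinearMap P'.primeCompl K) a
    obtain ⟨t', s₁, hs₁, hts⟩ := hden s' s'.2
    have hk' : algebraMap S T (algebraMap R S s₁) • a =
        LocalizedModule.mkLinearMap P'.primeCompl K (t' • k) := by
      rw [map_smul, ← hk, Submonoid.smul_def, smul_smul, hts,
        ← IsScalarTower.algebraMap_apply R S T, IsScalarTower.algebraMap_apply R R' T,
        algebraMap_smul]
    have h1 := key (t' • k)
    rw [← hk', map_smul j', map_smul g', algebraMap_smul (R := S) T (algebraMap R S s₁),
      algebraMap_smul (R := S) T (algebraMap R S s₁), map_smul H, map_smul l] at h1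
    have hu₁ := IsLocalization.map_units S (⟨s₁, hs₁⟩ : P.primeCompl)
    rw [smul_comm] at h1
    exact hu₁.smul_left_cancel.1 h1)
  obtain ⟨s', hs', G, hG⟩ := exists_extension_smul P'.primeCompl j g
    (G'.restrictScalars R' ∘ₗ ι) (fun a ↦ by
      have := DFunLike.congr_fun hG' (LocalizedModule.mkLinearMap P'.primeCompl K a)
      rw [LinearMap.comp_apply, hj', hg'] at this
      exact this)
  exact hg s' hs' G hG

end Localize

section DimensionShift

open Abelian

variable {R : Type u} [CommRing R]

lemma ext_eq_sum_of_sum_comp_eq_id {ι : Type*} [Fintype ι] {X Y : ModuleCat.{u} R}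
    {Z : ι → ModuleCat.{u} R} (a : ∀ i, Z i ⟶ X) (q : ∀ i, X ⟶ Z i) (h : ∑ i, q i ≫ a i = 𝟙 X)
    {n : ℕ} (e : Abelian.Ext X Y n) :
    e = ∑ i, (Ext.mk₀ (q i)).comp ((Ext.mk₀ (a i)).comp e (zero_add n)) (zero_add n) := by
  have h1 : (Ext.mk₀ (∑ i, q i ≫ a i)).comp e (zero_add n) = e := by
    rw [h, Ext.mk₀_id_comp]
  rw [Ext.mk₀_sum, Ext.sum_comp] at h1
  simpa using h1.symm

/-- Elementwise torsion of `Ext` groups passes to finite direct sums. -/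
lemma exists_smul_ext_eq_zero_of_sum_comp_eq_id {ι : Type*} [Fintype ι] {X Y : ModuleCat.{u} R}
    {Z : ι → ModuleCat.{u} R} (a : ∀ i, Z i ⟶ X) (q : ∀ i, X ⟶ Z i) (h : ∑ i, q i ≫ a i = 𝟙 X)
    {n : ℕ} (W : Submonoid R) (e : Abelian.Ext X Y n)
    (hW : ∀ i, ∃ s ∈ W, s • (Ext.mk₀ (a i)).comp e (zero_add n) = 0) : ∃ s ∈ W, s • e = 0 := by
  classical
  choose s hs hs' using hW
  refine ⟨∏ i, s i, W.prod_mem fun i _ ↦ hs i, ?_⟩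
  rw [ext_eq_sum_of_sum_comp_eq_id a q h e, Finset.smul_sum]
  refine Finset.sum_eq_zero fun i _ ↦ ?_
  rw [← Finset.prod_erase_mul _ _ (Finset.mem_univ i), mul_smul, ← Ext.comp_smul, hs',
    Ext.comp_zero, smul_zero]

variable {A B C : Type u} [AddCommGroup A] [AddCommGroup B] [AddCommGroup C] [Module R A]
  [Module R B] [Module R C]

lemma extClass_comp_mk₀_eq_zero_iff {f : A →ₗ[R] B} {g : B →ₗ[R] C} {w}
    (hS : (ShortComplex.mk (ModuleCat.ofHom f) (ModuleCat.ofHom g) w).ShortExact) {Y : Type u}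
    [AddCommGroup Y] [Module R Y] (φ : A →ₗ[R] Y) :
    hS.extClass.comp (Ext.mk₀ (ModuleCat.ofHom φ)) (add_zero 1) = 0 ↔
      ∃ G : B →ₗ[R] Y, G ∘ₗ f = φ := by
  constructor
  · intro h
    obtain ⟨x, hx⟩ := Ext.contravariant_sequence_exact₁ hS _ _ _ h
    obtain ⟨x, rfl⟩ := (Ext.mk₀_bijective _ _).2 x
    rw [Ext.mk₀_comp_mk₀] at hx
    have := (Ext.mk₀_bijective _ _).1 hx
    exact ⟨x.hom, by simpa using congr($(this).hom)⟩
  · rintro ⟨G, rfl⟩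
    rw [ModuleCat.ofHom_comp, ← Ext.mk₀_comp_mk₀]
    exact ShortComplex.ShortExact.extClass_comp_assoc hS _


lemma exists_extClass_comp_eq_of_projective {f : A →ₗ[R] B} {g : B →ₗ[R] C} {w}
    (hS : (ShortComplex.mk (ModuleCat.ofHom f) (ModuleCat.ofHom g) w).ShortExact)
    [Module.Projective R B] {Y : ModuleCat.{u} R} {n : ℕ}
    (e : Abelian.Ext (ModuleCat.of R C) Y (n + 1)) :
    ∃ x : Abelian.Ext (ModuleCat.of R A) Y n, hS.extClass.comp x (add_comm 1 n) = e := by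
  have : Projective (ModuleCat.of R B) := ModuleCat.projective_of_categoryTheory_projective _
  exact Ext.contravariant_sequence_exact₃ hS Y e (Ext.eq_zero_of_projective _) (add_comm 1 n)

lemma eq_zero_of_extClass_comp_of_projective {f : A →ₗ[R] B} {g : B →ₗ[R] C} {w}
    (hS : (ShortComplex.mk (ModuleCat.ofHom f) (ModuleCat.ofHom g) w).ShortExact)
    [Module.Projective R B] {Y : ModuleCat.{u} R} {n : ℕ}
    (x : Abelian.Ext (ModuleCat.of R A) Y (n + 1))
    (hx : hS.extClass.comp x (add_comm 1 (n + 1)) = 0) : x = 0 := by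
  have : Projective (ModuleCat.of R B) := ModuleCat.projective_of_categoryTheory_projective _
  obtain ⟨y, rfl⟩ := Ext.contravariant_sequence_exact₁ hS Y x _ hx
  rw [Ext.eq_zero_of_projective y]
  exact Ext.comp_zero _ _ _ _ _

lemma shortExact_localizedModule_map (W : Submonoid R) (f : A →ₗ[R] B) (g : B →ₗ[R] C)
    (hf : Function.Injective f) (hg : Function.Surjective g) (h : Function.Exact f g) :
    (ShortComplex.mk (ModuleCat.ofHom (LocalizedModule.map W f))
      (ModuleCat.ofHom (LocalizedModule.map W g)) (by
        rw [← ModuleCat.ofHom_comp]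
        ext x
        exact (LocalizedModule.map_exact W f g h _).2 ⟨x, rfl⟩)).ShortExact :=
  shortExact_of_exact _ _ (LocalizedModule.map_injective W _ hf)
    (LocalizedModule.map_surjective W _ hg) (fun y ↦ LocalizedModule.map_exact W f g h y)

/-- If the `Ext` modules of the localization vanish, then every class over the base ring is
annihilated by a denominator. -/
theorem exists_smul_ext_eq_zero_of_localized [IsNoetherianRing R] (W : Submonoid R) (n : ℕ)
    (M : Type u) [AddCommGroup M] [Module R M] [Module.Finite R M]
    (hM : ∀ k, Subsingleton (Abelian.Ext (ModuleCat.of (Localization W) (LocalizedModule W M))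
      (ModuleCat.of (Localization W) (Localization W)) (k + 1)))
    (e : Abelian.Ext (ModuleCat.of R M) (ModuleCat.of R R) (n + 1)) :
    ∃ s ∈ W, s • e = 0 := by
  induction n generalizing M with
  | zero =>
    obtain ⟨b, f, hf⟩ := Module.Finite.exists_fin' R M
    have hS := shortExact_of_exact (LinearMap.ker f).subtype f (Submodule.subtype_injective _) hf
      (LinearMap.exact_subtype_ker_map f)
    have hW := shortExact_localizedModule_map W (LinearMap.ker f).subtype f
      (Submodule.subtype_injective _) hf (LinearMap.exact_subtype_ker_map f)
    obtain ⟨x, rfl⟩ := exists_extClass_comp_eq_of_projective hS e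
    obtain ⟨φ, rfl⟩ := (Ext.mk₀_bijective _ _).2 x
    obtain ⟨φ', hφ'⟩ := exists_localized_lift W
      (Algebra.linearMap R (Localization W) ∘ₗ φ.hom)
    obtain ⟨G, hG⟩ := (extClass_comp_mk₀_eq_zero_iff hW φ').1
      ((hM 0).elim _ _)
    obtain ⟨s, hs, G', hG'⟩ := exists_extension_smul W (LinearMap.ker f).subtype φ.hom
      (G.restrictScalars R ∘ₗ LocalizedModule.mkLinearMap W _) (fun a ↦ by
        have := hφ' a
        rw [← hG] at this
        simpa using this)
    refine ⟨s, hs, ?_⟩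
    rw [← Ext.comp_smul, ← Ext.mk₀_smul]
    exact (extClass_comp_mk₀_eq_zero_iff hS (s • φ.hom)).2 ⟨G', hG'⟩
  | succ n ih =>
    obtain ⟨b, f, hf⟩ := Module.Finite.exists_fin' R M
    have hS := shortExact_of_exact (LinearMap.ker f).subtype f (Submodule.subtype_injective _) hf
      (LinearMap.exact_subtype_ker_map f)
    have hW := shortExact_localizedModule_map W (LinearMap.ker f).subtype f
      (Submodule.subtype_injective _) hf (LinearMap.exact_subtype_ker_map f)
    obtain ⟨x, rfl⟩ := exists_extClass_comp_eq_of_projective hS e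
    obtain ⟨s, hs, hx⟩ := ih (LinearMap.ker f)
      (fun k ↦ subsingleton_of_forall_eq 0 fun y ↦
        eq_zero_of_extClass_comp_of_projective hW y ((hM _).elim _ _)) x
    exact ⟨s, hs, by rw [← Ext.comp_smul, hx, Ext.comp_zero]⟩

end DimensionShift

section Transfer

open Abelian IsLocalRing RingTheory.Sequence

lemma exists_smul_ext_pi_eq_zero {R X Y : Type u} [CommRing R] [AddCommGroup X] [Module R X]
    [AddCommGroup Y] [Module R Y] (W : Submonoid R) {n b : ℕ}
    (h : ∀ e : Abelian.Ext (ModuleCat.of R X) (ModuleCat.of R Y) n, ∃ s ∈ W, s • e = 0)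
    (e : Abelian.Ext (ModuleCat.of R (Fin b → X)) (ModuleCat.of R Y) n) : ∃ s ∈ W, s • e = 0 :=
  exists_smul_ext_eq_zero_of_sum_comp_eq_id
    (fun i ↦ ModuleCat.ofHom (LinearMap.single R (fun _ : Fin b ↦ X) i))
    (fun i ↦ ModuleCat.ofHom (LinearMap.proj i))
    (by
      ext x i
      simp [ModuleCat.hom_sum]) W e fun _ ↦ h _

variable {R R' : Type u} [CommRing R] [CommRing R'] [IsNoetherianRing R']
  [Algebra R R'] {P : Ideal R} [P.IsPrime] {P' : Ideal R'}

/-- Transfer of classes in `Ext` with annihilator `P'` over `R'` to classes with annihilator `P`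
over `R`. -/
theorem exists_ext_restrictScalars
    (hcomap : ∀ r ∈ P, algebraMap R R' r ∈ P')
    (hvan : ∀ (k : ℕ) (v : Abelian.Ext (ModuleCat.of R R') (ModuleCat.of R R) (k + 1)),
      ∃ s ∈ P.primeCompl, s • v = 0)
    (hlin : ∀ (K : Type u) [AddCommGroup K] [Module R' K] [Module.Finite R' K] (b : ℕ)
      (j : K →ₗ[R'] (Fin b → R')) (g : K →ₗ[R'] R'),
      (∀ s' ∉ P', ∀ G : (Fin b → R') →ₗ[R'] R', G ∘ₗ j ≠ s' • g) →
      ∃ l : R' →ₗ[R] R, ∀ s ∉ P, ∀ G : (Fin b → R') →ₗ[R] R, ∃ a, G (j a) ≠ s * l (g a))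
    (n : ℕ) (N : Type u) [AddCommGroup N] [Module R' N] [Module R N] [IsScalarTower R R' N]
    [Module.Finite R' N] (z : Abelian.Ext (ModuleCat.of R' N) (ModuleCat.of R' R') n)
    (hz : ∀ r ∈ P', r • z = 0) (hz' : ∀ s ∉ P', s • z ≠ 0) :
    ∃ w : Abelian.Ext (ModuleCat.of R N) (ModuleCat.of R R) n,
      (∀ r ∈ P, r • w = 0) ∧ ∀ s ∉ P, s • w ≠ 0 := by
  induction n generalizing N with
  | zero =>
    obtain ⟨g, rfl⟩ := (Ext.mk₀_bijective _ _).2 z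
    obtain ⟨l, hl⟩ := hlin N 0 0 g.hom (fun s hs G h ↦ hz' s hs (by
      rw [← Ext.mk₀_smul, ← Ext.mk₀_zero]
      congr 1
      ext a
      exact (DFunLike.congr_fun h a).symm.trans (map_zero G)))
    refine ⟨Ext.mk₀ (ModuleCat.ofHom (l ∘ₗ g.hom.restrictScalars R)), fun r hr ↦ ?_,
      fun s hs h ↦ ?_⟩
    · have h0 := hz _ (hcomap r hr)
      rw [← Ext.mk₀_smul, ← Ext.mk₀_zero] at h0 ⊢
      have h0 := (Ext.mk₀_bijective _ _).1 h0
      congr 1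
      ext a
      have h1 : algebraMap R R' r • g.hom a = 0 := congr($(h0).hom a)
      have h2 : r • l (g.hom a) = 0 := by
        rw [← map_smul, ← algebraMap_smul R' r (g.hom a), h1, map_zero]
      exact h2
    · rw [← Ext.mk₀_smul, ← Ext.mk₀_zero] at h
      have h := (Ext.mk₀_bijective _ _).1 h
      obtain ⟨a, ha⟩ := hl s hs 0
      exact ha (congr($(h).hom a)).symm
  | succ n ih =>
    obtain ⟨b, f, hf⟩ := Module.Finite.exists_fin' R' N
    have hS' := shortExact_of_exact (LinearMap.ker f).subtype f (Submodule.subtype_injective _) hf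
      (LinearMap.exact_subtype_ker_map f)
    have hS := shortExact_of_exact ((LinearMap.ker f).subtype.restrictScalars R)
      (f.restrictScalars R) (Submodule.subtype_injective _) hf
      (LinearMap.exact_subtype_ker_map f)
    obtain ⟨x, rfl⟩ := exists_extClass_comp_eq_of_projective hS' z
    cases n with
    | zero =>
      obtain ⟨g, rfl⟩ := (Ext.mk₀_bijective _ _).2 x
      have key (s : R') : s • hS'.extClass.comp (Ext.mk₀ g) (add_comm 1 0) = 0 ↔
          ∃ G : (Fin b → R') →ₗ[R'] R', G ∘ₗ (LinearMap.ker f).subtype = s • g.hom := by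
        rw [← Ext.comp_smul, ← Ext.mk₀_smul]
        exact extClass_comp_mk₀_eq_zero_iff hS' (s • g.hom)
      obtain ⟨l, hl⟩ := hlin (LinearMap.ker f) b (LinearMap.ker f).subtype g.hom
        (fun s hs G h ↦ hz' s hs ((key s).2 ⟨G, h⟩))
      have key' (s : R) : s • hS.extClass.comp
          (Ext.mk₀ (ModuleCat.ofHom (l ∘ₗ g.hom.restrictScalars R))) (add_comm 1 0) = 0 ↔
          ∃ G : (Fin b → R') →ₗ[R] R, G ∘ₗ (LinearMap.ker f).subtype.restrictScalars R =
            s • (l ∘ₗ g.hom.restrictScalars R) := by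
        rw [← Ext.comp_smul, ← Ext.mk₀_smul]
        exact extClass_comp_mk₀_eq_zero_iff hS (s • (l ∘ₗ g.hom.restrictScalars R))
      refine ⟨hS.extClass.comp (Ext.mk₀ (ModuleCat.ofHom (l ∘ₗ g.hom.restrictScalars R)))
        (add_comm 1 0), fun r hr ↦ ?_, fun s hs h ↦ ?_⟩
      · obtain ⟨G, hG⟩ := (key _).1 (hz _ (hcomap r hr))
        refine (key' r).2 ⟨l ∘ₗ G.restrictScalars R, ?_⟩
        ext a
        have h1 : G a.1 = algebraMap R R' r • g.hom a := DFunLike.congr_fun hG a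
        have h2 : l (G a.1) = r • l (g.hom a) := by
          rw [h1, algebraMap_smul, map_smul]
        exact h2
      · obtain ⟨G, hG⟩ := (key' s).1 h
        obtain ⟨a, ha⟩ := hl s hs G
        exact ha (DFunLike.congr_fun hG a)
    | succ n =>
      obtain ⟨w, hw, hw'⟩ := ih (LinearMap.ker f) x
        (fun r hr ↦ eq_zero_of_extClass_comp_of_projective hS' _ (by
          rw [Ext.comp_smul]; exact hz r hr))
        (fun s hs h ↦ hz' s hs (by rw [← Ext.comp_smul, h, Ext.comp_zero]))
      refine ⟨hS.extClass.comp w (add_comm 1 _), fun r hr ↦ ?_, fun s hs h ↦ ?_⟩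
      · rw [← Ext.comp_smul, hw r hr, Ext.comp_zero]
      · rw [← Ext.comp_smul] at h
        obtain ⟨v, hv⟩ := Ext.contravariant_sequence_exact₁ hS _ _ _ h
        obtain ⟨t, ht, htv⟩ := exists_smul_ext_pi_eq_zero P.primeCompl (hvan n) v
        refine hw' (t * s) (P.primeCompl.mul_mem ht hs) ?_
        rw [mul_smul, ← hv, ← Ext.comp_smul, htv]
        exact Ext.comp_zero _ _ _ _ _

end Transfer

section Frobenius

open Abelian IsLocalRing RingTheory.Sequence

/-- If `R'` is `R` with `R` acting through powers, localizing `R'` at a prime over `R'` and over `R`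
amounts to the same. -/
lemma isLocalizedModule_of_algebraMap_eq_pow {R R' : Type u} [CommRing R] [CommRing R']
    [Algebra R R'] {P : Ideal R} [P.IsPrime] {P' : Ideal R'} [P'.IsPrime] (ε : R ≃+* R') {q : ℕ}
    (hq : q ≠ 0) (halg : ∀ r, algebraMap R R' r = ε r ^ q) (hP : ∀ r, ε r ∈ P' ↔ r ∈ P) :
    IsLocalizedModule P.primeCompl
      (IsScalarTower.toAlgHom R R' (Localization.AtPrime P')).toLinearMap where
  map_units s := by
    have hs : ε s ∈ P'.primeCompl := fun h ↦ s.2 ((hP _).1 h)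
    obtain ⟨u, hu⟩ := (IsLocalization.map_units (Localization.AtPrime P')
      (⟨ε s, hs⟩ : P'.primeCompl)).pow q
    refine (Module.End.isUnit_iff _).2 ?_
    convert! MulAction.bijective (β := Localization.AtPrime P') u using 1
    ext x
    rw [Units.smul_def, hu, Module.algebraMap_end_apply, ← map_pow, ← halg, algebraMap_smul,
      algebraMap_smul]
  surj y := by
    obtain ⟨⟨x, s'⟩, hx⟩ := IsLocalization.surj P'.primeCompl y
    obtain ⟨s, hs⟩ := ε.surjective s'
    have hsP : s ∈ P.primeCompl := fun h ↦ s'.2 (hs ▸ (hP s).2 h)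
    refine ⟨⟨s' ^ (q - 1) * x, ⟨s, hsP⟩⟩, ?_⟩
    simp only [AlgHom.toLinearMap_apply, IsScalarTower.coe_toAlgHom', map_mul, ← hx]
    rw [Submonoid.smul_def, Algebra.smul_def, IsScalarTower.algebraMap_apply R R', halg, hs]
    obtain ⟨q, rfl⟩ := Nat.exists_eq_succ_of_ne_zero hq
    simp only [Nat.succ_eq_add_one, Nat.add_sub_cancel, map_pow]
    ring
  exists_of_eq {x y} h := by
    obtain ⟨c, hc⟩ := IsLocalization.exists_of_eq (M := P'.primeCompl)
      (S := Localization.AtPrime P') (x := x) (y := y) h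
    obtain ⟨s, hs⟩ := ε.surjective c
    have hsP : s ∈ P.primeCompl := fun h ↦ c.2 (hs ▸ (hP s).2 h)
    refine ⟨⟨s, hsP⟩, ?_⟩
    rw [Submonoid.smul_def, Submonoid.smul_def, Algebra.smul_def, Algebra.smul_def, halg, hs]
    obtain ⟨q, rfl⟩ := Nat.exists_eq_succ_of_ne_zero hq
    rw [Nat.succ_eq_add_one, pow_succ, mul_assoc, mul_assoc, hc]

variable {R R' : Type u} [CommRing R] [IsNoetherianRing R] [CommRing R'] [IsNoetherianRing R']
  [Algebra R R'] [Module.Finite R R'] {P : Ideal R} [P.IsPrime] {P' : Ideal R'} [P'.IsPrime]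

/-- Transfer of classes in `Ext` along a power of the Frobenius. -/
theorem exists_ext_of_algebraMap_eq_pow (ε : R ≃+* R') {q : ℕ} (hq : q ≠ 0)
    (halg : ∀ r, algebraMap R R' r = ε r ^ q) (hP : ∀ r, ε r ∈ P' ↔ r ∈ P) {d : ℕ}
    (hS : HasSelfInjDim (Localization.AtPrime P) d) (hT : HasSelfInjDim (Localization.AtPrime P') d)
    (n : ℕ) (N : Type u) [AddCommGroup N] [Module R' N] [Module R N] [IsScalarTower R R' N]
    [Module.Finite R' N] (z : Abelian.Ext (ModuleCat.of R' N) (ModuleCat.of R' R') n)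
    (hz : ∀ r ∈ P', r • z = 0) (hz' : ∀ s ∉ P', s • z ≠ 0) :
    ∃ w : Abelian.Ext (ModuleCat.of R N) (ModuleCat.of R R) n,
      (∀ r ∈ P, r • w = 0) ∧ ∀ s ∉ P, s • w ≠ 0 := by
  let S := Localization.AtPrime P
  let T := Localization.AtPrime P'
  have hloc := isLocalizedModule_of_algebraMap_eq_pow ε hq halg hP
  have hmap : P.primeCompl.map ε.toMonoidHom = P'.primeCompl := by
    ext x
    constructor
    · rintro ⟨y, hy, rfl⟩
      exact fun h ↦ hy ((hP y).1 h)
    · intro hx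
      obtain ⟨y, rfl⟩ := ε.surjective x
      exact ⟨y, fun h ↦ hx ((hP y).2 h), rfl⟩
  have hunit (s : P.primeCompl) : IsUnit (algebraMap R T s) := by
    rw [IsScalarTower.algebraMap_apply R R' T, halg, map_pow]
    exact (IsLocalization.map_units T
      (⟨ε s, fun h ↦ s.2 ((hP _).1 h)⟩ : P'.primeCompl)).pow q
  let φ : S →+* T := IsLocalization.lift (M := P.primeCompl) hunit
  let := φ.toAlgebra
  have hφ (r : R) : φ (algebraMap R S r) = algebraMap R T r := IsLocalization.lift_eq hunit r
  have : IsScalarTower R S T := .of_algebraMap_eq fun r ↦ (hφ r).symm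
  have : Module.Finite S T := Module.Finite.of_isLocalizedModule P.primeCompl
    (IsScalarTower.toAlgHom R R' T).toLinearMap
  let εT : S ≃+* T := IsLocalization.ringEquivOfRingEquiv S T ε hmap
  have hεT (r : R) : εT (algebraMap R S r) = algebraMap R' T (ε r) :=
    IsLocalization.ringEquivOfRingEquiv_eq hmap r
  have hφε (s : S) : φ s = εT s ^ q := by
    obtain ⟨⟨r, t⟩, h⟩ := IsLocalization.surj P.primeCompl s
    have key (r : R) : φ (algebraMap R S r) = εT (algebraMap R S r) ^ q := by
      rw [hφ, hεT, ← map_pow, ← halg, ← IsScalarTower.algebraMap_apply R R' T]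
    refine (hunit t).mul_left_injective ?_
    change φ s * algebraMap R T t = εT s ^ q * algebraMap R T t
    rw [← hφ, ← map_mul, h, key, key, ← h, map_mul, mul_pow]
  have hεmem (s : S) (hs : s ∈ maximalIdeal S) : εT s ∈ maximalIdeal T := by
    rw [mem_maximalIdeal, mem_nonunits_iff] at hs ⊢
    rwa [MulEquiv.isUnit_map]
  have hreg (rs : List S) (hmem : ∀ r ∈ rs, r ∈ maximalIdeal S) (h : IsWeaklyRegular S rs) :
      IsWeaklyRegular T rs := by
    rw [← isWeaklyRegular_map_algebraMap_iff T T rs]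
    have h1 : rs.map (algebraMap S T) = (rs.map εT).map (· ^ q) := by
      rw [List.map_map]
      exact List.map_congr_left fun s _ ↦ hφε s
    rw [h1]
    refine isWeaklyRegular_map_pow (by simpa using fun s hs ↦ hεmem s (hmem s hs)) ?_ hq
    refine (AddEquiv.isWeaklyRegular_congr (e := εT.toAddEquiv) ?_).1 h
    exact List.forall₂_map_right_iff.2 (List.forall₂_same.2 fun s _ x ↦ map_mul εT s x)
  refine exists_ext_restrictScalars (P' := P') (fun r hr ↦ ?_) (fun k v ↦ ?_)
    (fun K _ _ _ b j g hg ↦ ?_) n N z hz hz'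
  · rw [halg]
    exact Ideal.pow_mem_of_mem _ ((hP r).2 hr) _ (Nat.pos_of_ne_zero hq)
  · obtain ⟨rs, hlen, hmem, hrs⟩ := hS.exists_isWeaklyRegular 1 le_rfl
    simp only [pow_one] at hmem
    have : Module.Finite S (LocalizedModule P.primeCompl R') :=
      Module.Finite.of_isLocalizedModule P.primeCompl (LocalizedModule.mkLinearMap P.primeCompl R')
    let i := (IsLocalizedModule.iso P.primeCompl
      (IsScalarTower.toAlgHom R R' T).toLinearMap).extendScalarsOfIsLocalization P.primeCompl S
    exact exists_smul_ext_eq_zero_of_localized P.primeCompl k R' (fun k ↦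
      hS.ext_subsingleton hlen hmem ((i.isWeaklyRegular_congr rs).2 (hreg rs hmem hrs))
        k.succ_pos) v
  · refine exists_linearMap_forall_not_extension hS hT (fun s hs ↦ ?_) hreg (fun s' hs' ↦ ?_) j g hg
    · change φ s ∈ _
      rw [hφε]
      exact Ideal.pow_mem_of_mem _ (hεmem s hs) _ (Nat.pos_of_ne_zero hq)
    · obtain ⟨s, rfl⟩ := ε.surjective s'
      refine ⟨ε s ^ (q - 1), s, fun h ↦ hs' ((hP s).2 h), ?_⟩
      rw [halg, ← pow_succ, Nat.sub_add_cancel (Nat.pos_of_ne_zero hq)]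

end Frobenius

section Bridge

open Abelian

variable {R : Type u} [CommRing R] {X Y : ModuleCat.{u} R} (Q : ProjectiveResolution X)

lemma extMk_zero_eq_zero_iff (f : Q.complex.X 0 ⟶ Y) (hf : Q.complex.d 1 0 ≫ f = 0) :
    Q.extMk f 1 rfl hf = 0 ↔ f = 0 := by
  simp only [← Q.extEquivCohomologyClass.apply_eq_iff_eq,
    ProjectiveResolution.extEquivCohomologyClass_extMk,
    ProjectiveResolution.extEquivCohomologyClass_zero,
    CochainComplex.HomComplex.CohomologyClass.mk_eq_zero_iff]
  rw [CochainComplex.HomComplex.Cocycle.toSingleMk_mem_coboundaries_iff _ _ _ _ _ 1 (by simp)]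
  have hz : Limits.IsZero (Q.cochainComplex.X 1) :=
    CochainComplex.isZero_of_isStrictlyLE _ 0 _ (by simp)
  constructor
  · rintro ⟨g, hg⟩
    rw [hz.eq_of_tgt (Q.cochainComplex.d _ 1) 0, Limits.zero_comp] at hg
    exact (Preadditive.IsIso.comp_left_eq_zero _ _).1 hg.symm
  · rintro rfl
    exact ⟨0, by simp⟩

lemma smul_extMk {n : ℕ} (f : Q.complex.X n ⟶ Y) (m : ℕ) (hm : n + 1 = m)
    (hf : Q.complex.d m n ≫ f = 0) (r : R) :
    r • Q.extMk f m hm hf = Q.extMk (r • f) m hm (by simp [hf]) := by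
  rw [Ext.smul_eq_comp_mk₀, Q.extMk_comp_mk₀]
  simp

/-- The inclusion of the cocycles computing `Ext` in the module of morphisms. -/
noncomputable def cyclesToHom (Y : ModuleCat.{u} R) (n : ℕ) :
    (Q.complex.linearYonedaObj R Y).cycles n →ₗ[R] (Q.complex.X n ⟶ Y) :=
  ((Q.complex.linearYonedaObj R Y).iCycles n).hom

lemma d_comp_cyclesToHom (n : ℕ) (c : (Q.complex.linearYonedaObj R Y).cycles n) :
    Q.complex.d (n + 1) n ≫ cyclesToHom Q Y n c = 0 :=
  congr($((Q.complex.linearYonedaObj R Y).iCycles_d n (n + 1)).hom c)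

lemma cyclesToHom_injective (n : ℕ) : Function.Injective (cyclesToHom Q Y n) :=
  (ModuleCat.mono_iff_injective ((Q.complex.linearYonedaObj R Y).iCycles n)).1 inferInstance

lemma exists_cyclesToHom_eq {n : ℕ} (f : Q.complex.X n ⟶ Y) (hf : Q.complex.d (n + 1) n ≫ f = 0) :
    ∃ c, cyclesToHom Q Y n c = f := by
  let K := Q.complex.linearYonedaObj R Y
  have h := ShortComplex.exact_of_f_is_kernel (.mk (K.iCycles n) (K.d n (n + 1)) (by simp))
    (K.cyclesIsKernel n (n + 1) (by simp))
  exact (ShortComplex.moduleCat_exact_iff _).1 h f hf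

/-- The class in `Ext` of a cocycle. -/
noncomputable def cyclesToExt (Y : ModuleCat.{u} R) (n : ℕ) :
    (Q.complex.linearYonedaObj R Y).cycles n →ₗ[R] Abelian.Ext X Y n where
  toFun c := Q.extMk (cyclesToHom Q Y n c) (n + 1) rfl (d_comp_cyclesToHom Q n c)
  map_add' c c' := by
    rw [Q.add_extMk]
    congr 1
    exact map_add _ _ _
  map_smul' r c := by
    rw [RingHom.id_apply, smul_extMk]
    congr 1
    exact map_smul _ _ _

lemma cyclesToExt_surjective (n : ℕ) : Function.Surjective (cyclesToExt Q Y n) := by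
  intro e
  obtain ⟨f, hf, rfl⟩ := Q.extMk_surjective e (n + 1) rfl
  obtain ⟨c, rfl⟩ := exists_cyclesToHom_eq Q f hf
  exact ⟨c, rfl⟩

lemma ker_cyclesToExt (n : ℕ) : LinearMap.ker (cyclesToExt Q Y n) =
    LinearMap.ker ((Q.complex.linearYonedaObj R Y).homologyπ n).hom := by
  ext c
  let K := Q.complex.linearYonedaObj R Y
  have hK (i : ℕ) (hi : (ComplexShape.up ℕ).prev n = i) :
      c ∈ LinearMap.ker (K.homologyπ n).hom ↔ ∃ g, K.toCycles i n g = c :=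
    ⟨(ShortComplex.moduleCat_exact_iff _).1 (ShortComplex.exact_of_g_is_cokernel
      (.mk (K.toCycles i n) (K.homologyπ n) (by simp)) (K.homologyIsCokernel _ n hi)) c, by
      rintro ⟨g, rfl⟩
      exact congr($(K.toCycles_comp_homologyπ i n).hom g)⟩
  have hd (i : ℕ) (g : K.X i) : cyclesToHom Q Y n (K.toCycles i n g) = K.d i n g :=
    congr($(K.toCycles_i i n).hom g)
  cases n with
  | zero =>
    rw [hK 0 (by simp)]
    refine (extMk_zero_eq_zero_iff Q _ (d_comp_cyclesToHom Q 0 c)).trans ?_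
    constructor
    · intro h
      refine ⟨0, (map_zero _).trans (cyclesToHom_injective Q 0 ?_)⟩
      rw [h, map_zero]
    · rintro ⟨g, rfl⟩
      rw [hd, K.shape _ _ (by simp)]
      rfl
  | succ n =>
    rw [hK n (by simp)]
    refine (Q.extMk_eq_zero_iff _ _ rfl (d_comp_cyclesToHom Q _ c) n rfl).trans ?_
    constructor
    · rintro ⟨g, hg⟩
      exact ⟨g, cyclesToHom_injective Q _ ((hd n g).trans hg)⟩
    · rintro ⟨g, rfl⟩
      exact ⟨g, (hd n g).symm⟩

/-- The two constructions of `Ext` agree. -/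
noncomputable def extCatEquiv (n : ℕ) (X Y : ModuleCat.{u} R) :
    extCat R n X Y ≃ₗ[R] Abelian.Ext X Y n :=
  let Q := projectiveResolution X
  (Q.isoExt n Y).toLinearEquiv ≪≫ₗ
    (((Q.complex.linearYonedaObj R Y).homologyπ n).hom.quotKerEquivOfSurjective
      ((ModuleCat.epi_iff_surjective _).1 inferInstance)).symm ≪≫ₗ
    Submodule.quotEquivOfEq _ _ (ker_cyclesToExt Q n).symm ≪≫ₗ
    (cyclesToExt Q Y n).quotKerEquivOfSurjective (cyclesToExt_surjective Q n)

end Bridge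

section Colimit

open Abelian Limits

variable {R : Type u} [CommRing R]

lemma mem_associatedPrimes_iff_exists_annihilator [IsNoetherianRing R] {M : Type*} [AddCommGroup M]
    [Module R M] {P : Ideal R} : P ∈ associatedPrimes R M ↔
      P.IsPrime ∧ ∃ x : M, (∀ r ∈ P, r • x = 0) ∧ ∀ s ∉ P, s • x ≠ 0 := by
  refine (isAssociatedPrime_iff (I := P) (M := M)).trans (and_congr_right fun _ ↦
    exists_congr fun x ↦ ?_)
  rw [SetLike.ext_iff]
  simp only [Submodule.mem_colon_singleton, Submodule.mem_bot]
  exact ⟨fun h ↦ ⟨fun r ↦ (h r).1, fun s hs h' ↦ hs ((h s).2 h')⟩,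
    fun h r ↦ ⟨h.1 r, fun h' ↦ by_contra fun hr ↦ h.2 r hr h'⟩⟩

instance preservesFilteredColimits_forget_moduleCat :
    PreservesFilteredColimitsOfSize.{0, 0} (forget (ModuleCat.{u} R)) :=
  preservesFilteredColimitsOfSize_shrink.{0, u, 0, u} _

lemma exists_map_annihilated_of_fg {J : Type} [SmallCategory J] [IsFiltered J]
    (F : J ⥤ ModuleCat.{u} R) {c : Cocone F} (hc : IsColimit c) {P : Ideal R} (hP : P.FG)
    (k : J) (z : F.obj k) (hz : ∀ r ∈ P, r • c.ι.app k z = 0) :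
    ∃ (k' : J) (f : k ⟶ k'), ∀ r ∈ P, r • F.map f z = 0 := by
  induction P, hP using Submodule.fg_induction generalizing k with
  | singleton x =>
    obtain ⟨k', f, g, h⟩ := Concrete.isColimit_exists_of_rep_eq F hc (x • z) (0 : F.obj k)
      (by rw [map_smul, map_zero]; exact hz x (Submodule.mem_span_singleton_self x))
    refine ⟨k', f, fun r hr ↦ ?_⟩
    obtain ⟨a, rfl⟩ := Submodule.mem_span_singleton.1 hr
    rw [smul_assoc, ← map_smul, h, map_zero, smul_zero]
  | sup P₁ P₂ _ _ h₁ h₂ =>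
    obtain ⟨k₁, f₁, hf₁⟩ := h₁ k z fun r hr ↦ hz r (Ideal.mem_sup_left hr)
    obtain ⟨k₂, f₂, hf₂⟩ := h₂ k₁ (F.map f₁ z) fun r hr ↦ by
      rw [← ConcreteCategory.comp_apply, c.w f₁]
      exact hz r (Ideal.mem_sup_right hr)
    refine ⟨k₂, f₁ ≫ f₂, fun r hr ↦ ?_⟩
    obtain ⟨a, ha, b, hb, rfl⟩ := Submodule.mem_sup.1 hr
    rw [add_smul, F.map_comp, ConcreteCategory.comp_apply, hf₂ b hb, add_zero, ← map_smul,
      hf₁ a ha, map_zero]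

/-- The contravariant functoriality of `extCat`. -/
noncomputable def extCatMap (n : ℕ) {A B : ModuleCat.{u} R} (φ : A ⟶ B) (Y : ModuleCat.{u} R) :
    extCat R n B Y →ₗ[R] extCat R n A Y :=
  (((_root_.Ext R (ModuleCat.{u} R) n).map φ.op).app Y).hom

lemma extCatMap_comp (n : ℕ) {A B C : ModuleCat.{u} R} (φ : A ⟶ B) (ψ : B ⟶ C)
    (Y : ModuleCat.{u} R) (z : extCat R n C Y) :
    extCatMap n (φ ≫ ψ) Y z = extCatMap n φ Y (extCatMap n ψ Y z) := by
  unfold extCatMap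
  rw [op_comp, Functor.map_comp, NatTrans.comp_app]
  rfl

lemma exists_extCat_of_mem_associatedPrimes_localCohomology [IsNoetherianRing R] (I : Ideal R)
    (n : ℕ) {Y : ModuleCat.{u} R} {P : Ideal R}
    (hP : P ∈ associatedPrimes R ((localCohomology I n).obj Y)) :
    ∃ (k : ℕ) (z : extCat R n (ModuleCat.of R (R ⧸ I ^ k)) Y), (∀ r ∈ P, r • z = 0) ∧
      ∀ (k' : ℕ) (h : I ^ k' ≤ I ^ k), k ≤ k' → ∀ s ∉ P,
        s • extCatMap n (ModuleCat.ofHom (Submodule.mapQ (I ^ k') (I ^ k) LinearMap.id h)) Y z ≠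
          0 := by
  rw [mem_associatedPrimes_iff_exists_annihilator] at hP
  obtain ⟨-, x, hx, hx'⟩ := hP
  let D := localCohomology.diagram (localCohomology.idealPowersDiagram I) n
  have := localCohomology.hasColimitDiagram.{u, 0} (localCohomology.idealPowersDiagram I) n
  let F := D ⋙ (evaluation _ _).obj Y
  let c := ((evaluation _ _).obj Y).mapCocone (colimit.cocone D)
  have hc : IsColimit c := isColimitOfPreserves ((evaluation _ _).obj Y) (colimit.isColimit D)
  obtain ⟨k₀, z₀, hz₀⟩ := Concrete.isColimit_exists_rep F hc x
  obtain ⟨k, f, hf⟩ := exists_map_annihilated_of_fg F hc (IsNoetherian.noetherian P) k₀ z₀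
    (by rw [hz₀]; exact hx)
  have hz : c.ι.app k (F.map f z₀) = x := by
    rw [← ConcreteCategory.comp_apply, c.w f, hz₀]
  refine ⟨k.unop.unop, F.map f z₀, hf, fun k' hk' hkk' s hs h ↦ hx' s hs ?_⟩
  let g : k ⟶ Opposite.op (Opposite.op k') := (homOfLE hkk').op.op
  have hg : s • F.map g (F.map f z₀) = 0 := h
  rw [← hz, ← c.w g, ConcreteCategory.comp_apply]
  exact ((c.ι.app _).hom.map_smul s _).symm.trans ((congrArg _ hg).trans (map_zero _))

/-- An associated prime of local cohomology is the annihilator of a class in `Ext`, with respect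
to any sufficiently small ideal which is cofinal with the powers. -/
theorem exists_ext_of_mem_associatedPrimes_localCohomology [IsNoetherianRing R] (I : Ideal R)
    (n : ℕ) {Y : ModuleCat.{u} R} {P : Ideal R}
    (hP : P ∈ associatedPrimes R ((localCohomology I n).obj Y)) :
    ∃ k, ∀ J : Ideal R, J ≤ I ^ k → (∃ k', I ^ k' ≤ J) →
      ∃ z : Abelian.Ext (ModuleCat.of R (R ⧸ J)) Y n,
        (∀ r ∈ P, r • z = 0) ∧ ∀ s ∉ P, s • z ≠ 0 := by
  obtain ⟨k, z, hz, hz'⟩ := exists_extCat_of_mem_associatedPrimes_localCohomology I n hP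
  refine ⟨k, fun J hJ ⟨k', hk'⟩ ↦ ?_⟩
  let π : ModuleCat.of R (R ⧸ J) ⟶ ModuleCat.of R (R ⧸ I ^ k) :=
    ModuleCat.ofHom (Submodule.mapQ _ _ LinearMap.id hJ)
  refine ⟨extCatEquiv n _ _ (extCatMap n π Y z), fun r hr ↦ ?_, fun s hs h ↦ ?_⟩
  · rw [← map_smul, ← map_smul, hz r hr, map_zero, map_zero]
  · rw [← map_smul, LinearEquiv.map_eq_zero_iff] at h
    have hJ' : I ^ max k k' ≤ J := (Ideal.pow_le_pow_right (le_max_right _ _)).trans hk'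
    let π' : ModuleCat.of R (R ⧸ I ^ max k k') ⟶ ModuleCat.of R (R ⧸ J) :=
      ModuleCat.ofHom (Submodule.mapQ _ _ LinearMap.id hJ')
    have hπ : ModuleCat.ofHom (Submodule.mapQ (I ^ max k k') (I ^ k) LinearMap.id
        (hJ'.trans hJ)) = π' ≫ π := by
      ext
      rfl
    apply hz' (max k k') (hJ'.trans hJ) (le_max_left _ _) s hs
    rw [hπ, extCatMap_comp, ← map_smul, h, map_zero]

end Colimit

section FrobeniusPushforward

/-- The `e`-th Frobenius pushforward of `R`: the ring `R`, regarded as an `R`-algebra through the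
`e`-th iterate of the Frobenius endomorphism. -/
def FrobeniusPushforward (R : Type u) (_p _e : ℕ) : Type u := R

variable (R : Type u) [CommRing R] (p e : ℕ)

instance FrobeniusPushforward.instCommRing : CommRing (FrobeniusPushforward R p e) :=
  inferInstanceAs (CommRing R)

instance FrobeniusPushforward.instAlgebra [ExpChar R p] : Algebra R (FrobeniusPushforward R p e) :=
  (iterateFrobenius R p e).toAlgebra

/-- The identity map from `R` to its Frobenius pushforward, as a ring isomorphism. -/
def FrobeniusPushforward.equiv : R ≃+* FrobeniusPushforward R p e := RingEquiv.refl R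

variable {R}

lemma FrobeniusPushforward.algebraMap_apply [ExpChar R p] (r : R) :
    algebraMap R (FrobeniusPushforward R p e) r = FrobeniusPushforward.equiv R p e r ^ p ^ e :=
  rfl

variable {p e} in
/-- A presentation of the Frobenius pushforward given by an additive equivalence is linear. -/
noncomputable def FrobeniusPushforward.linearEquivOfAddEquiv [ExpChar R p] {N : Type*}
    [AddCommGroup N] [Module R N] (ψ : R ≃+ N) (hψ : ∀ r y : R, ψ (r ^ p ^ e * y) = r • ψ y) :
    FrobeniusPushforward R p e ≃ₗ[R] N :=
  { ψ with
    map_smul' := fun r y ↦ by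
      rw [Algebra.smul_def]
      exact hψ r y }

end FrobeniusPushforward

section Decomposition

open Abelian

variable {R : Type u} [CommRing R]

lemma exists_ext_of_sum_comp_eq_id {ι : Type} [Fintype ι] {X Y : ModuleCat.{u} R}
    {Z : ι → ModuleCat.{u} R} {n : ℕ} (a : ∀ i, Z i ⟶ X) (q : ∀ i, X ⟶ Z i)
    (h : ∑ i, q i ≫ a i = 𝟙 X) {P : Ideal R} [P.IsPrime] (w : Abelian.Ext X Y n)
    (hw : ∀ r ∈ P, r • w = 0) (hw' : ∀ s ∉ P, s • w ≠ 0) :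
    ∃ i, ∃ w' : Abelian.Ext (Z i) Y n, (∀ r ∈ P, r • w' = 0) ∧ ∀ s ∉ P, s • w' ≠ 0 := by
  by_contra! H
  obtain ⟨s, hs, hsw⟩ := exists_smul_ext_eq_zero_of_sum_comp_eq_id a q h P.primeCompl w fun i ↦ by
    obtain ⟨s, hs, hsw⟩ := H i ((Ext.mk₀ (a i)).comp w (zero_add n)) fun r hr ↦ by
      rw [← Ext.comp_smul, hw r hr, Ext.comp_zero]
    exact ⟨s, hs, hsw⟩
  exact hw' s hs hsw

lemma exists_ext_quotient_of_linearEquiv_directSum {t : ℕ} {M : Fin t → Type u}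
    [∀ i, AddCommGroup (M i)] [∀ i, Module R (M i)] {m : Fin t → ℕ} {N : Type u} [AddCommGroup N]
    [Module R N] (ψ : N ≃ₗ[R] ⨁ i, (Fin (m i) → M i)) (I : Ideal R) {Y : ModuleCat.{u} R} {n : ℕ}
    {X : Type u} [AddCommGroup X] [Module R X] (l : (N ⧸ (I • ⊤ : Submodule R N)) ≃ₗ[R] X)
    {P : Ideal R} [P.IsPrime] (w : Abelian.Ext (ModuleCat.of R X) Y n)
    (hw : ∀ r ∈ P, r • w = 0) (hw' : ∀ s ∉ P, s • w ≠ 0) :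
    ∃ i, ∃ w' : Abelian.Ext (ModuleCat.of R (M i ⧸ (I • ⊤ : Submodule R (M i)))) Y n,
      (∀ r ∈ P, r • w' = 0) ∧ ∀ s ∉ P, s • w' ≠ 0 := by
  let a (x : Σ i, Fin (m i)) : M x.1 →ₗ[R] N :=
    ψ.symm.toLinearMap ∘ₗ DirectSum.lof R (Fin t) (fun i ↦ Fin (m i) → M i) x.1 ∘ₗ
      LinearMap.single R (fun _ ↦ M x.1) x.2
  let b (x : Σ i, Fin (m i)) : N →ₗ[R] M x.1 :=
    LinearMap.proj x.2 ∘ₗ DirectSum.component R (Fin t) (fun i ↦ Fin (m i) → M i) x.1 ∘ₗ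
      ψ.toLinearMap
  have hab (y : N) : ∑ x, a x (b x y) = y := by
    rw [Fintype.sum_sigma]
    apply ψ.injective
    rw [map_sum]
    refine Eq.trans (Finset.sum_congr rfl fun i _ ↦ ?_) (DirectSum.sum_univ_of (ψ y))
    simp only [a, b, LinearMap.comp_apply, LinearEquiv.coe_coe, LinearMap.coe_single]
    rw [← map_sum, LinearEquiv.apply_symm_apply]
    exact (map_sum (DirectSum.lof R (Fin t) (fun i ↦ Fin (m i) → M i) i) _ _).symm.trans
      (congrArg _ (Finset.univ_sum_single (ψ y i)))
  obtain ⟨x, w', h⟩ := exists_ext_of_sum_comp_eq_id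
    (Z := fun x : Σ i, Fin (m i) ↦ ModuleCat.of R (M x.1 ⧸ (I • ⊤ : Submodule R (M x.1))))
    (fun x ↦ ModuleCat.ofHom (l.toLinearMap ∘ₗ
      Submodule.mapQ _ _ (a x) (Submodule.smul_top_le_comap_smul_top I (a x))))
    (fun x ↦ ModuleCat.ofHom
      (Submodule.mapQ _ _ (b x) (Submodule.smul_top_le_comap_smul_top I (b x)) ∘ₗ
        l.symm.toLinearMap))
    (by
      ext y
      obtain ⟨y, rfl⟩ := l.surjective y
      obtain ⟨y, rfl⟩ := Submodule.Quotient.mk_surjective _ y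
      rw [ModuleCat.hom_sum, LinearMap.sum_apply]
      simp only [ModuleCat.hom_comp, ModuleCat.hom_ofHom, LinearMap.comp_apply,
        LinearEquiv.coe_coe, LinearEquiv.symm_apply_apply, Submodule.mapQ_apply, ModuleCat.hom_id,
        LinearMap.id_apply]
      rw [← map_sum, ← Submodule.mkQ_apply]
      simp only [← Submodule.mkQ_apply]
      rw [← map_sum, hab]) w hw hw'
  exact ⟨x.1, w', h⟩

end Decomposition

section Main

open Abelian

variable {R : Type u} [CommRing R] [IsNoetherianRing R] (p : ℕ) [ExpChar R p]

lemma exists_frobeniusPower_cofinal (hp : 1 < p) (I : Ideal R) (k : ℕ) :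
    ∃ e, I.map (iterateFrobenius R p e) ≤ I ^ k ∧
      ∃ k', I ^ k' ≤ I.map (iterateFrobenius R p e) := by
  refine ⟨k, ?_, ?_⟩
  · rw [Ideal.map_le_iff_le_comap]
    exact fun x hx ↦ Ideal.pow_le_pow_right (Nat.lt_pow_self hp).le (Ideal.pow_mem_pow hx _)
  · refine Ideal.exists_pow_le_of_le_radical_of_fg (fun x hx ↦ ⟨p ^ k, ?_⟩)
      (IsNoetherian.noetherian I)
    exact Ideal.mem_map_of_mem (iterateFrobenius R p k) hx

lemma exists_hasSelfInjDim_of_isGorensteinLocalRing {S : Type u} [CommRing S]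
    [IsLocalRing S] (h : IsGorensteinLocalRing S) : ∃ d, HasSelfInjDim S d := by
  obtain ⟨_, _, n, hn⟩ := h
  exact exists_hasSelfInjDim (n := n) fun M i hi ↦
    have := hn M i hi
    (extCatEquiv i M (ModuleCat.of S S)).symm.injective.subsingleton

set_option maxHeartbeats 400000 in
/-- An associated prime of `H_I^n(R)` at which `R` is Gorenstein is an associated prime of one of
the modules `Ext^n(M_i / I M_i, R)`. -/
theorem exists_mem_associatedPrimes_extCat (hp : 1 < p) {t : ℕ} (M : Fin t → Type u)
    [∀ i, AddCommGroup (M i)] [∀ i, Module R (M i)] (hfg : ∀ i, Module.Finite R (M i))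
    (hFFRT : ∀ e : ℕ, ∃ (m : Fin t → ℕ) (ψ : R ≃+ ⨁ i : Fin t, (Fin (m i) → M i)),
      ∀ r y : R, ψ (r ^ p ^ e * y) = r • ψ y)
    (I : Ideal R) (n : ℕ) {P : Ideal R} [hPp : P.IsPrime]
    (hP : P ∈ associatedPrimes R ((localCohomology I n).obj (ModuleCat.of R R)))
    (hG : IsGorensteinLocalRing (Localization.AtPrime P)) :
    ∃ i, P ∈ associatedPrimes R (extCat R n
      (ModuleCat.of R (M i ⧸ (I • ⊤ : Submodule R (M i)))) (ModuleCat.of R R)) := by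
  obtain ⟨d, hd⟩ := exists_hasSelfInjDim_of_isGorensteinLocalRing hG
  obtain ⟨k, hk⟩ := exists_ext_of_mem_associatedPrimes_localCohomology I n hP
  obtain ⟨e, he, he'⟩ := exists_frobeniusPower_cofinal p hp I k
  obtain ⟨z, hz, hz'⟩ := hk _ he he'
  obtain ⟨m, ψ, hψ⟩ := hFFRT e
  let R' := FrobeniusPushforward R p e
  let φ : R' ≃ₗ[R] ⨁ i, (Fin (m i) → M i) := FrobeniusPushforward.linearEquivOfAddEquiv ψ hψ
  have : IsNoetherianRing R' := inferInstanceAs (IsNoetherianRing R)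
  have : Module.Finite R R' := Module.Finite.equiv φ.symm
  let P' : Ideal R' := P
  have : P'.IsPrime := hPp
  let J : Ideal R' := I.map (algebraMap R R')
  let z' : Abelian.Ext (ModuleCat.of R' (R' ⧸ J)) (ModuleCat.of R' R') n := z
  obtain ⟨w, hw, hw'⟩ := exists_ext_of_algebraMap_eq_pow (P := P) (P' := P')
    (FrobeniusPushforward.equiv R p e) (pow_ne_zero e (zero_lt_one.trans hp).ne')
    (FrobeniusPushforward.algebraMap_apply p e) (fun _ ↦ Iff.rfl) hd hd n (R' ⧸ J) z' hz hz'
  let l : (R' ⧸ (I • ⊤ : Submodule R R')) ≃ₗ[R] R' ⧸ J :=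
    (Submodule.quotEquivOfEq _ _ (Ideal.smul_top_eq_map I)).trans
      (Submodule.Quotient.restrictScalarsEquiv R J)
  obtain ⟨i, w', h₁, h₂⟩ := exists_ext_quotient_of_linearEquiv_directSum φ I l w hw hw'
  refine ⟨i, ?_⟩
  rw [LinearEquiv.AssociatedPrimes.eq (extCatEquiv n _ _),
    mem_associatedPrimes_iff_exists_annihilator]
  exact ⟨hPp, w', h₁, h₂⟩

lemma finite_associatedPrimes_extCat (n : ℕ) (X Y : ModuleCat.{u} R) [Module.Finite R X]
    [Module.Finite R Y] : (associatedPrimes R (extCat R n X Y)).Finite := by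
  rw [LinearEquiv.AssociatedPrimes.eq (extCatEquiv n _ _)]
  exact associatedPrimes.finite R _

end Main

/-- Let `R` be a Noetherian ring of prime characteristic `p` with finite
F-representation type by finitely generated `R`-modules `M_1, …, M_t`.  Let `I` be an
ideal of `R` and `n` an integer.  Then
`Ass_R H_I^n(R) ∩ Gor R ⊆ ⋃_i Ass_R Ext_R^n(M_i/IM_i, R)`.  In particular,
`Ass_R H_I^n(R)` is a finite set if `R` is a semilocal ring such that `R_𝔭` is Gorenstein
for each nonmaximal prime ideal `𝔭`. -/
theorem stmt4 {R : Type u} [CommRing R] [IsNoetherianRing R]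
    (p : ℕ) (hp : p.Prime) [CharP R p]
    -- finite F-representation type by finitely generated modules `M_1, …, M_t`:
    (t : ℕ) (M : Fin t → Type u) [∀ i, AddCommGroup (M i)] [∀ i, Module R (M i)]
    (hfg : ∀ i, Module.Finite R (M i))
    (hFFRT : ∀ e : ℕ, ∃ (m : Fin t → ℕ)
      (ψ : R ≃+ ⨁ i : Fin t, (Fin (m i) → M i)),
        ∀ r y : R, ψ (r ^ p ^ e * y) = r • ψ y)
    (I : Ideal R) (n : ℕ) :
    (associatedPrimes R ((localCohomology I n).obj (ModuleCat.of R R)) ∩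
        gorensteinLocus R ⊆
      ⋃ i : Fin t, associatedPrimes R
        (extCat R n (ModuleCat.of R ((M i) ⧸ (I • (⊤ : Submodule R (M i)))))
          (ModuleCat.of R R))) ∧
    (({J : Ideal R | J.IsMaximal}.Finite ∧
        ∀ (P : Ideal R) (h : P.IsPrime), ¬P.IsMaximal →
          IsGorensteinLocalRing (Localization (@Ideal.primeCompl R _ P h))) →
      (associatedPrimes R ((localCohomology I n).obj (ModuleCat.of R R))).Finite) := by
  have : ExpChar R p := ExpChar.prime hp
  have key : associatedPrimes R ((localCohomology I n).obj (ModuleCat.of R R)) ∩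
      gorensteinLocus R ⊆ ⋃ i : Fin t, associatedPrimes R
        (extCat R n (ModuleCat.of R ((M i) ⧸ (I • (⊤ : Submodule R (M i)))))
          (ModuleCat.of R R)) := by
    rintro P ⟨hP, _, hG⟩
    exact Set.mem_iUnion.2
      (exists_mem_associatedPrimes_extCat p hp.one_lt M hfg hFFRT I n hP hG)
  refine ⟨key, fun ⟨hmax, hG⟩ ↦ ?_⟩
  refine ((Set.finite_iUnion fun i ↦ finite_associatedPrimes_extCat n (ModuleCat.of R
    ((M i) ⧸ (I • (⊤ : Submodule R (M i))))) (ModuleCat.of R R)).union hmax).subset fun P hP ↦ ?_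
  by_cases hPm : P.IsMaximal
  · exact Or.inr hPm
  · exact Or.inl (key ⟨hP, hP.isPrime, hG P hP.isPrime hPm⟩)
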